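/- Let s₀ > 1/2 and s ≥ s₀. There is a constant C > 0 (depending on s, s₀ and the dyadic partition) such that for all smooth functions a, g : 𝕋² → ℝ, ( Σ_{k≥−1} 2^{2ks} ‖Δ^v_k R^v(a,g)‖²_{L²_v(L^{4/3}_h)} )^{1/2} ≤ C ‖a‖_{H^{1/4,s}} ‖g‖_{H^{0,s₀}}. -/

import Mathlib

open MeasureTheory Real Complex Filter Set

noncomputable section

namespace Aniso

/-- Fundamental domain `(0, 2π]` for the circle of circumference `2π`. -/
def I2pi : Set ℝ := Set.Ioc 0 (2 * π)

/-- Fundamental domain for the 2-torus `𝕋² = (ℝ/2πℤ)²`. -/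
def Q2 : Set (ℝ × ℝ) := I2pi ×ˢ I2pi

/-- Integral over the torus of a real function. -/
def tintR (f : ℝ × ℝ → ℝ) : ℝ := ∫ x in Q2, f x

/-- Smoothness of a scalar field. -/
def Smooth (f : ℝ × ℝ → ℝ) : Prop := ContDiff ℝ (⊤ : ℕ∞) f

/-- Smoothness of a vector field. -/
def SmoothV (u : ℝ × ℝ → ℝ × ℝ) : Prop := ContDiff ℝ (⊤ : ℕ∞) u

/-- `2π`-periodicity in each variable: this encodes being a function on the torus. -/
def Per (f : ℝ × ℝ → ℝ) : Prop :=
  (∀ x : ℝ × ℝ, f (x.1 + 2 * π, x.2) = f x) ∧ (∀ x : ℝ × ℝ, f (x.1, x.2 + 2 * π) = f x)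

def PerV (u : ℝ × ℝ → ℝ × ℝ) : Prop :=
  Per (fun x => (u x).1) ∧ Per (fun x => (u x).2)

/-- Partial derivative in the horizontal variable `x₁`. -/
def pd1 (f : ℝ × ℝ → ℝ) : ℝ × ℝ → ℝ := fun x => fderiv ℝ f x (1, 0)

/-- Partial derivative in the vertical variable `x₂`. -/
def pd2 (f : ℝ × ℝ → ℝ) : ℝ × ℝ → ℝ := fun x => fderiv ℝ f x (0, 1)

def comp1 (u : ℝ × ℝ → ℝ × ℝ) : ℝ × ℝ → ℝ := fun x => (u x).1
def comp2 (u : ℝ × ℝ → ℝ × ℝ) : ℝ × ℝ → ℝ := fun x => (u x).2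

def pd1V (u : ℝ × ℝ → ℝ × ℝ) : ℝ × ℝ → ℝ × ℝ := fun x => (pd1 (comp1 u) x, pd1 (comp2 u) x)
def pd2V (u : ℝ × ℝ → ℝ × ℝ) : ℝ × ℝ → ℝ × ℝ := fun x => (pd2 (comp1 u) x, pd2 (comp2 u) x)

/-- Divergence-free condition `∂₁u¹ + ∂₂u² = 0`. -/
def DivFree (u : ℝ × ℝ → ℝ × ℝ) : Prop :=
  ∀ x, pd1 (comp1 u) x + pd2 (comp2 u) x = 0

/-- The transport term `u·∇v`, with components `u¹∂₁vʲ + u²∂₂vʲ`. -/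
def advect (u v : ℝ × ℝ → ℝ × ℝ) : ℝ × ℝ → ℝ × ℝ := fun x =>
  ((u x).1 * pd1 (comp1 v) x + (u x).2 * pd2 (comp1 v) x,
   (u x).1 * pd1 (comp2 v) x + (u x).2 * pd2 (comp2 v) x)

/-- L² inner product of real vector fields on the torus (summed over components). -/
def ipV (u v : ℝ × ℝ → ℝ × ℝ) : ℝ := tintR fun x => (u x).1 * (v x).1 + (u x).2 * (v x).2

/-- The trilinear form `b(u,v,w) = ∫ (u·∇v)·w`. -/
def b3 (u v w : ℝ × ℝ → ℝ × ℝ) : ℝ := ipV (advect u v) w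

/-- L² norm of a scalar function on the torus. -/
def L2 (f : ℝ × ℝ → ℝ) : ℝ := Real.sqrt (tintR fun x => f x ^ 2)

/-- L² norm of a vector field on the torus. -/
def L2V (u : ℝ × ℝ → ℝ × ℝ) : ℝ := Real.sqrt (tintR fun x => (u x).1 ^ 2 + (u x).2 ^ 2)

/-- Fourier coefficient of a complex-valued function on the torus. -/
def fcC (f : ℝ × ℝ → ℂ) (k : ℤ × ℤ) : ℂ :=
  (1 / (2 * π) ^ 2 : ℂ) *
    ∫ x in Q2, f x * Complex.exp (-(Complex.I) * ((k.1 : ℂ) * (x.1 : ℂ) + (k.2 : ℂ) * (x.2 : ℂ)))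

/-- Fourier coefficient of a real-valued function on the torus. -/
def fc (f : ℝ × ℝ → ℝ) (k : ℤ × ℤ) : ℂ := fcC (fun x => (f x : ℂ)) k

/-- Anisotropic Sobolev weight `(1+|k₁|²)^s (1+|k₂|²)^{s'}`. -/
def aw (s s' : ℝ) (k : ℤ × ℤ) : ℝ :=
  (1 + (k.1 : ℝ) ^ 2) ^ s * (1 + (k.2 : ℝ) ^ 2) ^ s'

/-- Square of the anisotropic Sobolev norm `H^{s,s'}` of a scalar function. -/
def HSq (s s' : ℝ) (f : ℝ × ℝ → ℝ) : ℝ := ∑' k : ℤ × ℤ, aw s s' k * ‖fc f k‖ ^ 2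

/-- Anisotropic Sobolev norm `H^{s,s'}` of a scalar function. -/
def HN (s s' : ℝ) (f : ℝ × ℝ → ℝ) : ℝ := Real.sqrt (HSq s s' f)

/-- Anisotropic Sobolev norm `H^{s,s'}` of a vector field. -/
def HNV (s s' : ℝ) (u : ℝ × ℝ → ℝ × ℝ) : ℝ :=
  Real.sqrt (HSq s s' (comp1 u) + HSq s s' (comp2 u))

/-- Mixed norm `L^∞_h(L²_v)`. -/
def LinfhL2v (f : ℝ × ℝ → ℝ) : ℝ :=
  essSup (fun x1 : ℝ => Real.sqrt (∫ x2 in I2pi, f (x1, x2) ^ 2)) (volume.restrict I2pi)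

/-- Mixed norm `L²_h(L^∞_v)`. -/
def L2hLinfv (f : ℝ × ℝ → ℝ) : ℝ :=
  Real.sqrt (∫ x1 in I2pi, (essSup (fun x2 : ℝ => |f (x1, x2)|) (volume.restrict I2pi)) ^ 2)

/-- Mixed norm `L²_v(L^{4/3}_h)`. -/
def L2vL43h {E : Type*} [NormedAddCommGroup E] (f : ℝ × ℝ → E) : ℝ :=
  Real.sqrt (∫ x2 in I2pi, (∫ x1 in I2pi, ‖f (x1, x2)‖ ^ ((4 : ℝ)/3)) ^ ((3 : ℝ)/2))

/-- Mixed norm `L^∞_v(L²_h)`. -/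
def LinfvL2h {E : Type*} [NormedAddCommGroup E] (f : ℝ × ℝ → E) : ℝ :=
  essSup (fun x2 : ℝ => Real.sqrt (∫ x1 in I2pi, ‖f (x1, x2)‖ ^ 2)) (volume.restrict I2pi)

/-- Mixed norm `L²_v(L⁴_h)`. -/
def L2vL4h {E : Type*} [NormedAddCommGroup E] (f : ℝ × ℝ → E) : ℝ :=
  Real.sqrt (∫ x2 in I2pi, Real.sqrt (∫ x1 in I2pi, ‖f (x1, x2)‖ ^ 4))

/-- One-dimensional Fourier coefficient on the circle of circumference `2π`. -/
def fc1 (g : ℝ → ℂ) (n : ℤ) : ℂ :=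
  (1 / (2 * π) : ℂ) * ∫ x in I2pi, g x * Complex.exp (-(Complex.I) * ((n : ℂ) * (x : ℂ)))

/-- Square of the 1-d Sobolev norm `H^s(𝕋)`. -/
def H1Sq (s : ℝ) (g : ℝ → ℂ) : ℝ := ∑' n : ℤ, (1 + (n : ℝ) ^ 2) ^ s * ‖fc1 g n‖ ^ 2

/-- Mixed norm `L²_v(H^s_h)`. -/
def L2vHsh (s : ℝ) (f : ℝ × ℝ → ℂ) : ℝ :=
  Real.sqrt (∫ x2 in I2pi, H1Sq s (fun x1 => f (x1, x2)))

/-- A dyadic partition of unity `(χ, θ)` on `ℝ`. -/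
structure IsDyadicPartition (χ θ : ℝ → ℝ) : Prop where
  smooth_chi : ContDiff ℝ (⊤ : ℕ∞) χ
  smooth_theta : ContDiff ℝ (⊤ : ℕ∞) θ
  nonneg_chi : ∀ z, 0 ≤ χ z
  nonneg_theta : ∀ z, 0 ≤ θ z
  even_chi : ∀ z, χ (-z) = χ z
  even_theta : ∀ z, θ (-z) = θ z
  chi_support : ∃ R > 0, ∀ z, R ≤ |z| → χ z = 0
  theta_support : ∃ r R : ℝ, 0 < r ∧ r < R ∧ ∀ z, (|z| < r ∨ R < |z|) → θ z = 0
  partition : ∀ z : ℝ, χ z + ∑' j : ℕ, θ ((2 : ℝ) ^ (-(j : ℤ)) * z) = 1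
  chi_theta_disj : ∀ j : ℕ, 1 ≤ j → ∀ z, χ z * θ ((2 : ℝ) ^ (-(j : ℤ)) * z) = 0
  theta_theta_disj : ∀ i j : ℕ, 1 < |(i : ℤ) - (j : ℤ)| → ∀ z,
    θ ((2 : ℝ) ^ (-(i : ℤ)) * z) * θ ((2 : ℝ) ^ (-(j : ℤ)) * z) = 0

/-- The Fourier multiplier symbol of the vertical Littlewood–Paley block `Δ^v_j`. -/
def blockSymb (χ θ : ℝ → ℝ) (j : ℤ) (z : ℝ) : ℝ :=
  if j = -1 then χ |z| else if 0 ≤ j then θ ((2 : ℝ) ^ (-j) * |z|) else 0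

/-- The Fourier multiplier symbol of the vertical low-frequency cut-off `S^v_j`. -/
def lowSymb (χ θ : ℝ → ℝ) (j : ℤ) (z : ℝ) : ℝ :=
  ∑ j' ∈ Finset.Icc (-1 : ℤ) (j - 2), blockSymb χ θ j' z

/-- The character `e^{ik·x}`. -/
def eK (k : ℤ × ℤ) (x : ℝ × ℝ) : ℂ :=
  Complex.exp (Complex.I * ((k.1 : ℂ) * (x.1 : ℂ) + (k.2 : ℂ) * (x.2 : ℂ)))

/-- Vertical Littlewood–Paley block `Δ^v_j` of a complex-valued function. -/
def LPC (χ θ : ℝ → ℝ) (j : ℤ) (f : ℝ × ℝ → ℂ) : ℝ × ℝ → ℂ :=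
  fun x => ∑' k : ℤ × ℤ, (blockSymb χ θ j k.2 : ℂ) * fcC f k * eK k x

/-- Vertical Littlewood–Paley block `Δ^v_j` of a real-valued function. -/
def LP (χ θ : ℝ → ℝ) (j : ℤ) (f : ℝ × ℝ → ℝ) : ℝ × ℝ → ℂ :=
  LPC χ θ j fun x => (f x : ℂ)

/-- Vertical low-frequency cut-off `S^v_j` of a complex-valued function. -/
def SvC (χ θ : ℝ → ℝ) (j : ℤ) (f : ℝ × ℝ → ℂ) : ℝ × ℝ → ℂ :=
  fun x => ∑' k : ℤ × ℤ, (lowSymb χ θ j k.2 : ℂ) * fcC f k * eK k x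

/-- Vertical low-frequency cut-off `S^v_j` of a real-valued function. -/
def Sv (χ θ : ℝ → ℝ) (j : ℤ) (f : ℝ × ℝ → ℝ) : ℝ × ℝ → ℂ :=
  SvC χ θ j fun x => (f x : ℂ)

/-- Componentwise Littlewood–Paley block of a vector field. -/
def LPV (χ θ : ℝ → ℝ) (j : ℤ) (u : ℝ × ℝ → ℝ × ℝ) : ℝ × ℝ → ℂ × ℂ :=
  fun x => (LP χ θ j (comp1 u) x, LP χ θ j (comp2 u) x)

/-- Componentwise low-frequency cut-off of a vector field. -/
def SvV (χ θ : ℝ → ℝ) (j : ℤ) (u : ℝ × ℝ → ℝ × ℝ) : ℝ × ℝ → ℂ × ℂ :=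
  fun x => (Sv χ θ j (comp1 u) x, Sv χ θ j (comp2 u) x)

/-- L² inner product of complex-valued functions on the torus. -/
def ipC (f g : ℝ × ℝ → ℂ) : ℂ := ∫ x in Q2, f x * (starRingEnd ℂ) (g x)

/-- L² inner product of complex vector fields on the torus (summed over components). -/
def ipCV (f g : ℝ × ℝ → ℂ × ℂ) : ℂ :=
  ∫ x in Q2, ((f x).1 * (starRingEnd ℂ) ((g x).1) + (f x).2 * (starRingEnd ℂ) ((g x).2))

/-- The vertical paraproduct `T^v_a g = Σ_j S^v_{j-1}a · Δ^v_j g`. -/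
def Tv (χ θ : ℝ → ℝ) (a g : ℝ × ℝ → ℝ) : ℝ × ℝ → ℂ :=
  fun x => ∑' j : ℤ, Sv χ θ (j - 1) a x * LP χ θ j g x

/-- The vertical remainder `R^v(a,g) = Σ_{|j-j'|≤1} Δ^v_j a · Δ^v_{j'} g`. -/
def Rv (χ θ : ℝ → ℝ) (a g : ℝ × ℝ → ℝ) : ℝ × ℝ → ℂ :=
  fun x => ∑' p : ℤ × ℤ, if |p.1 - p.2| ≤ 1 then LP χ θ p.1 a x * LP χ θ p.2 g x else 0


/-- The character `e^{inx}` of the circle. -/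
def e1 (n : ℤ) (x : ℝ) : ℂ := Complex.exp (Complex.I * ((n : ℂ) * (x : ℂ)))

lemma e1_add (m n : ℤ) (x : ℝ) : e1 (m + n) x = e1 m x * e1 n x := by
  simp only [e1, ← Complex.exp_add]
  push_cast
  ring_nf

lemma e1_zero (x : ℝ) : e1 0 x = 1 := by simp [e1]

lemma norm_e1 (n : ℤ) (x : ℝ) : ‖e1 n x‖ = 1 := by
  have : Complex.I * ((n : ℂ) * (x : ℂ)) = ((n * x : ℝ) : ℂ) * Complex.I := by
    push_cast; ring
  rw [e1, this, Complex.norm_exp_ofReal_mul_I]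

lemma continuous_e1 (n : ℤ) : Continuous (e1 n) := by
  unfold e1; fun_prop

lemma conj_e1 (n : ℤ) (x : ℝ) : (starRingEnd ℂ) (e1 n x) = e1 (-n) x := by
  simp [e1, ← Complex.exp_conj]

lemma eK_eq (k : ℤ × ℤ) (x : ℝ × ℝ) : eK k x = e1 k.1 x.1 * e1 k.2 x.2 := by
  simp only [eK, e1, ← Complex.exp_add]
  ring_nf

lemma eK_add (k l : ℤ × ℤ) (x : ℝ × ℝ) : eK (k + l) x = eK k x * eK l x := by
  simp only [eK_eq, Prod.fst_add, Prod.snd_add, e1_add]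
  ring

lemma norm_eK (k : ℤ × ℤ) (x : ℝ × ℝ) : ‖eK k x‖ = 1 := by
  simp [eK_eq, norm_e1]

lemma continuous_eK (k : ℤ × ℤ) : Continuous (eK k) := by
  unfold eK; fun_prop

lemma integral_e1 (n : ℤ) : ∫ x in I2pi, e1 n x = if n = 0 then (2 * π : ℂ) else 0 := by
  have h2 : (0 : ℝ) ≤ 2 * π := by positivity
  rw [I2pi, ← intervalIntegral.integral_of_le h2]
  split_ifs with h
  · subst h
    simp [e1_zero]
  · have hc : Complex.I * (n : ℂ) ≠ 0 := by simp [h]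
    have := integral_exp_mul_complex (a := 0) (b := 2 * π) hc
    simp only [e1, ← mul_assoc]
    rw [this]
    have h1 : Complex.I * (n : ℂ) * ((2 * π : ℝ) : ℂ) = n * (2 * π * Complex.I) := by
      push_cast; ring
    rw [h1, Complex.exp_int_mul_two_pi_mul_I]
    simp

lemma volume_I2pi : volume I2pi = ENNReal.ofReal (2 * π) := by
  simp [I2pi]

instance : IsFiniteMeasure (volume.restrict I2pi) :=
  ⟨by rw [Measure.restrict_apply_univ, volume_I2pi]; exact ENNReal.ofReal_lt_top⟩

lemma restrict_Q2 :
    (volume : Measure (ℝ × ℝ)).restrict Q2 =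
      (volume.restrict I2pi).prod (volume.restrict I2pi) := by
  rw [Q2, Measure.volume_eq_prod, Measure.prod_restrict]

lemma integral_eK (k : ℤ × ℤ) :
    ∫ x in Q2, eK k x = if k = 0 then ((2 * π) ^ 2 : ℂ) else 0 := by
  simp only [eK_eq]
  rw [restrict_Q2, integral_prod_mul (fun x => e1 k.1 x) (fun y => e1 k.2 y), integral_e1,
    integral_e1]
  by_cases h1 : k.1 = 0 <;> by_cases h2 : k.2 = 0 <;> simp [h1, h2, Prod.ext_iff, pow_two]

lemma fcC_eq (f : ℝ × ℝ → ℂ) (k : ℤ × ℤ) :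
    fcC f k = (1 / (2 * π) ^ 2 : ℂ) * ∫ x in Q2, f x * eK (-k) x := by
  simp only [fcC, eK, Prod.fst_neg, Prod.snd_neg, Int.cast_neg]
  congr 2
  ext x
  congr 2
  ring

/-- Fourier coefficients of an absolutely convergent trigonometric series. -/
lemma fcC_tsum {ι : Type*} [Countable ι] {c : ι → ℂ} (hc : Summable fun i => ‖c i‖)
    (κ : ι → ℤ × ℤ) (k : ℤ × ℤ) :
    fcC (fun x => ∑' i, c i * eK (κ i) x) k = ∑' i, if κ i = k then c i else 0 := by
  have : IsFiniteMeasure ((volume : Measure (ℝ × ℝ)).restrict Q2) := by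
    rw [restrict_Q2]; infer_instance
  rw [fcC_eq]
  have hInt : ∀ i, Integrable (fun x => c i * eK (κ i) x * eK (-k) x)
      ((volume : Measure (ℝ × ℝ)).restrict Q2) := by
    intro i
    refine Integrable.of_bound (C := ‖c i‖)
      (((continuous_const.mul (continuous_eK _)).mul (continuous_eK _)).aestronglyMeasurable) ?_
    exact Eventually.of_forall fun x => by simp [norm_eK]
  have hsum : Summable fun i => ∫ x in Q2, ‖c i * eK (κ i) x * eK (-k) x‖ := by
    simp only [norm_mul, norm_eK, mul_one, integral_const, smul_eq_mul]
    exact hc.mul_left _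
  have := (hasSum_integral_of_summable_integral_norm hInt hsum).tsum_eq
  simp only [← tsum_mul_right]
  rw [← this, ← tsum_mul_left]
  refine tsum_congr fun i => ?_
  have : ∀ x, c i * eK (κ i) x * eK (-k) x = c i * eK (κ i - k) x := by
    intro x; rw [mul_assoc, ← eK_add, sub_eq_add_neg]
  simp only [this, integral_const_mul, integral_eK, sub_eq_zero]
  have hpi : ((2 * π) ^ 2 : ℂ) ≠ 0 := by
    simp [Real.pi_ne_zero]
  split_ifs
  · field_simp
  · simp

/-- Parseval's identity for absolutely convergent trigonometric series. -/
lemma lintegral_sq_tsum_e1 {c : ℤ → ℂ} (hc : Summable fun i => ‖c i‖) :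
    ∫⁻ x in I2pi, ‖∑' n, c n * e1 n x‖ₑ ^ 2 = ENNReal.ofReal (2 * π) * ∑' n, ‖c n‖ₑ ^ 2 := by
  set F : ℝ → ℂ := fun x => ∑' n, c n * e1 n x with hF
  have hFc : Continuous F := by
    refine continuous_tsum (fun n => continuous_const.mul (continuous_e1 n)) hc fun n x => ?_
    simp [norm_e1]
  have hFb : ∀ x, ‖F x‖ ≤ ∑' n, ‖c n‖ := fun x => by
    refine (norm_tsum_le_tsum_norm ?_).trans_eq ?_ <;> simp [norm_e1, hc]
  have hFn : ∀ m, ∫ x in I2pi, F x * e1 (-m) x = 2 * π * c m := by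
    intro m
    have hInt : ∀ i, Integrable (fun x => c i * e1 i x * e1 (-m) x) (volume.restrict I2pi) := by
      intro i
      refine Integrable.of_bound (C := ‖c i‖)
        (((continuous_const.mul (continuous_e1 _)).mul (continuous_e1 _)).aestronglyMeasurable) ?_
      exact Eventually.of_forall fun x => by simp [norm_e1]
    have hsum : Summable fun i => ∫ x in I2pi, ‖c i * e1 i x * e1 (-m) x‖ := by
      simp only [norm_mul, norm_e1, mul_one, integral_const, smul_eq_mul]
      exact hc.mul_left _
    have := (hasSum_integral_of_summable_integral_norm hInt hsum).tsum_eq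
    simp only [hF, ← tsum_mul_right]
    rw [← this, tsum_eq_single m]
    · simp only [mul_assoc, ← e1_add, add_neg_cancel, e1_zero, mul_one]
      simp [I2pi, Measure.real, Real.pi_pos.le, mul_assoc]
    · intro n hn
      simp only [mul_assoc, ← e1_add, integral_const_mul, integral_e1]
      simp [add_neg_eq_zero, hn]
  have hsum2 : ∫ x in I2pi, F x * (starRingEnd ℂ) (F x) =
      ∑' m, (2 * π * c m) * (starRingEnd ℂ) (c m) := by
    have hInt : ∀ i, Integrable (fun x => F x * e1 (-i) x * (starRingEnd ℂ) (c i))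
        (volume.restrict I2pi) := by
      intro i
      refine Integrable.of_bound (C := (∑' n, ‖c n‖) * ‖c i‖)
        (((hFc.mul (continuous_e1 _)).mul continuous_const).aestronglyMeasurable) ?_
      refine Eventually.of_forall fun x => ?_
      simp only [norm_mul, norm_e1, mul_one, RCLike.norm_conj]
      exact mul_le_mul_of_nonneg_right (hFb x) (norm_nonneg _)
    have hsum : Summable fun i => ∫ x in I2pi, ‖F x * e1 (-i) x * (starRingEnd ℂ) (c i)‖ := by
      simp only [norm_mul, norm_e1, mul_one, RCLike.norm_conj, integral_mul_const]
      exact hc.mul_left _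
    have := (hasSum_integral_of_summable_integral_norm hInt hsum).tsum_eq
    simp only [integral_mul_const, hFn] at this
    rw [this]
    refine integral_congr_ae (Eventually.of_forall fun x => ?_)
    simp only [mul_assoc]
    rw [tsum_mul_left]
    congr 1
    rw [hF]
    simp only
    rw [Complex.conj_tsum]
    refine tsum_congr fun n => ?_
    rw [map_mul, conj_e1, mul_comm]
  have hreal : ∫ x in I2pi, ‖F x‖ ^ 2 = 2 * π * ∑' m, ‖c m‖ ^ 2 := by
    have h1 : ∀ z : ℂ, z * (starRingEnd ℂ) z = ((‖z‖ ^ 2 : ℝ) : ℂ) := fun z => by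
      rw [Complex.mul_conj, Complex.normSq_eq_norm_sq]
    simp only [mul_assoc, h1] at hsum2
    rw [integral_complex_ofReal] at hsum2
    rw [← tsum_mul_left]
    apply Complex.ofReal_injective
    rw [hsum2, Complex.ofReal_tsum]
    refine tsum_congr fun m => ?_
    push_cast; ring
  have hsq : Summable fun m => ‖c m‖ ^ 2 := by
    have := hc.mul_norm hc
    have h2 := this.comp_injective (i := fun m : ℤ => (m, m)) (fun a b h => by simpa using h)
    refine h2.congr fun m => ?_
    simp [pow_two]
  have hl : ∫⁻ x in I2pi, ‖F x‖ₑ ^ 2 = ENNReal.ofReal (∫ x in I2pi, ‖F x‖ ^ 2) := by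
    rw [ofReal_integral_eq_lintegral_ofReal]
    · refine lintegral_congr fun x => ?_
      rw [ENNReal.ofReal_pow (norm_nonneg _), ofReal_norm]
    · refine Integrable.of_bound (C := (∑' n, ‖c n‖) ^ 2)
        ((hFc.norm.pow 2).aestronglyMeasurable) (Eventually.of_forall fun x => ?_)
      simp only [norm_pow, norm_norm]
      exact pow_le_pow_left₀ (norm_nonneg _) (hFb x) 2
    · exact Eventually.of_forall fun x => by positivity
  rw [hl, hreal, ENNReal.ofReal_mul (by positivity), ENNReal.ofReal_tsum_of_nonneg
    (fun _ => by positivity) hsq]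
  congr 1
  refine tsum_congr fun n => ?_
  rw [ENNReal.ofReal_pow (norm_nonneg _), ofReal_norm]

lemma lintegral_mul_sq_le {α : Type*} [MeasurableSpace α] (μ : Measure α) {f g : α → ENNReal}
    (hf : AEMeasurable f μ) (hg : AEMeasurable g μ) :
    (∫⁻ x, f x * g x ∂μ) ^ 2 ≤ (∫⁻ x, f x ^ 2 ∂μ) * ∫⁻ x, g x ^ 2 ∂μ := by
  have h := ENNReal.lintegral_mul_le_Lp_mul_Lq μ Real.HolderConjugate.two_two hf hg
  simp only [Pi.mul_apply, ENNReal.rpow_two] at h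
  refine (pow_le_pow_left' h 2).trans_eq ?_
  rw [mul_pow, ← ENNReal.rpow_natCast, ← ENNReal.rpow_natCast, ← ENNReal.rpow_mul,
    ← ENNReal.rpow_mul]
  norm_num

lemma tsum_mul_sq_le {ι : Type*} (f g : ι → ENNReal) :
    (∑' i, f i * g i) ^ 2 ≤ (∑' i, f i ^ 2) * ∑' i, g i ^ 2 := by
  let _ : MeasurableSpace ι := ⊤
  have h := lintegral_mul_sq_le (Measure.count : Measure ι) (f := f) (g := g)
    measurable_from_top.aemeasurable measurable_from_top.aemeasurable
  simpa only [lintegral_count] using h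

/-- Minkowski's inequality in `L²` for a countable family. -/
lemma lintegral_tsum_sq_le {α ι : Type*} [MeasurableSpace α] [Countable ι] (μ : Measure α)
    {f : ι → α → ENNReal} (hf : ∀ i, Measurable (f i)) {b : ι → ENNReal}
    (hb : ∀ i, ∫⁻ x, f i x ^ 2 ∂μ ≤ b i ^ 2) :
    ∫⁻ x, (∑' i, f i x) ^ 2 ∂μ ≤ (∑' i, b i) ^ 2 := by
  simp only [pow_two (∑' i, _), ← ENNReal.tsum_mul_left, ← ENNReal.tsum_mul_right]
  have hm : ∀ i j, Measurable fun x => f j x * f i x := fun i j => (hf j).mul (hf i)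
  rw [lintegral_tsum fun i => (Measurable.tsum fun j => hm i j).aemeasurable]
  refine ENNReal.tsum_le_tsum fun i => ?_
  rw [lintegral_tsum fun j => (hm i j).aemeasurable]
  refine ENNReal.tsum_le_tsum fun j => ?_
  have h := lintegral_mul_sq_le μ (hf j).aemeasurable (hf i).aemeasurable
  rw [← ENNReal.pow_le_pow_left_iff two_ne_zero, mul_pow]
  exact h.trans (mul_le_mul' (hb j) (hb i))

/-- Young's convolution inequality `ℓ² * ℓ¹ ⊂ ℓ²`. -/
lemma tsum_conv_sq_le (α β : ℤ → ENNReal) :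
    ∑' n, (∑' m, α m * β (n - m)) ^ 2 ≤ (∑' m, α m ^ 2) * (∑' l, β l) ^ 2 := by
  have hsub : ∀ n : ℤ, ∑' m, β (n - m) = ∑' l, β l := fun n =>
    (Equiv.subLeft n).tsum_eq β
  have hsub' : ∀ m : ℤ, ∑' n, β (n - m) = ∑' l, β l := fun m =>
    (Equiv.subRight m).tsum_eq β
  have hsq : ∀ t : ENNReal, t ^ (1 / 2 : ℝ) * t ^ (1 / 2 : ℝ) = t := fun t => by
    rw [← ENNReal.rpow_add_of_nonneg _ _ (by norm_num) (by norm_num)]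
    norm_num
  have key : ∀ n, (∑' m, α m * β (n - m)) ^ 2 ≤
      (∑' m, α m ^ 2 * β (n - m)) * ∑' l, β l := by
    intro n
    have h := tsum_mul_sq_le (fun m => α m * β (n - m) ^ (1 / 2 : ℝ))
      (fun m => β (n - m) ^ (1 / 2 : ℝ))
    simp only [mul_assoc, hsq, mul_pow] at h
    simpa only [pow_two (_ ^ _), hsq, hsub] using h
  calc ∑' n, (∑' m, α m * β (n - m)) ^ 2
      ≤ ∑' n, (∑' m, α m ^ 2 * β (n - m)) * ∑' l, β l := ENNReal.tsum_le_tsum key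
    _ = (∑' m, α m ^ 2) * (∑' l, β l) ^ 2 := by
        rw [ENNReal.tsum_mul_right, ENNReal.tsum_comm]
        simp only [ENNReal.tsum_mul_left, hsub', ENNReal.tsum_mul_right]
        ring

/-- The bijection `(n, m) ↦ (m, n - m)` of `ℤ × ℤ`. -/
def convEquiv : ℤ × ℤ ≃ ℤ × ℤ where
  toFun p := (p.2, p.1 - p.2)
  invFun q := (q.1 + q.2, q.1)
  left_inv p := by ext <;> simp
  right_inv q := by ext <;> simp

/-- Bessel-type bound for a double series over the frequencies `m + l`. -/
lemma lintegral_sq_tsum_conv_le {c : ℤ × ℤ → ℂ} (hc : Summable fun p => ‖c p‖) :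
    ∫⁻ x in I2pi, ‖∑' p, c p * e1 (p.1 + p.2) x‖ₑ ^ 2 ≤
      ENNReal.ofReal (2 * π) * ∑' n, (∑' m, ‖c (m, n - m)‖ₑ) ^ 2 := by
  have hc' : Summable fun q => ‖c (convEquiv q)‖ := convEquiv.summable_iff.2 hc
  have hfib : ∀ n, Summable fun m => ‖c (m, n - m)‖ := fun n => hc'.prod_factor n
  have hd : Summable fun n => ‖∑' m, c (m, n - m)‖ :=
    Summable.of_nonneg_of_le (fun _ => norm_nonneg _) (fun n => norm_tsum_le_tsum_norm (hfib n))
      hc'.prod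
  have heq : ∀ x, ∑' p, c p * e1 (p.1 + p.2) x = ∑' n, (∑' m, c (m, n - m)) * e1 n x := by
    intro x
    rw [← convEquiv.tsum_eq]
    have hs : Summable fun q => c (convEquiv q) * e1 ((convEquiv q).1 + (convEquiv q).2) x :=
      Summable.of_norm (by simpa [norm_e1] using hc')
    rw [hs.tsum_prod]
    refine tsum_congr fun n => ?_
    rw [← tsum_mul_right]
    refine tsum_congr fun m => ?_
    simp [convEquiv]
  simp only [heq]
  rw [lintegral_sq_tsum_e1 hd]
  gcongr
  exact enorm_tsum_le_tsum_enorm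

lemma sum_inv_sqrt_le (n : ℕ) :
    ∑ k ∈ Finset.range n, 1 / √((k : ℝ) + 1) ≤ 2 * √n := by
  induction n with
  | zero => simp
  | succ n ih =>
    rw [Finset.sum_range_succ]
    push_cast
    have h1 : 0 < √((n : ℝ) + 1) := by positivity
    have h0 : 0 ≤ √(n : ℝ) := Real.sqrt_nonneg _
    have e1 := Real.sq_sqrt (show (0 : ℝ) ≤ n + 1 by positivity)
    have e0 := Real.sq_sqrt (show (0 : ℝ) ≤ n by positivity)
    have : 1 / √((n : ℝ) + 1) ≤ 2 * √((n : ℝ) + 1) - 2 * √n := by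
      rw [div_le_iff₀ h1]
      nlinarith [sq_nonneg (√((n : ℝ) + 1) - √n)]
    linarith

lemma sum_inv_sqrt_mul_le (n : ℕ) :
    ∑ k ∈ Finset.range (n + 1), 1 / √((k : ℝ) + 1) * (1 / √(((n - k : ℕ) : ℝ) + 1)) ≤ 4 := by
  have hN : 0 < √((n : ℝ) + 1) := by positivity
  have hterm : ∀ k ∈ Finset.range (n + 1),
      1 / √((k : ℝ) + 1) * (1 / √(((n - k : ℕ) : ℝ) + 1)) ≤
        1 / √((n : ℝ) + 1) * (1 / √((k : ℝ) + 1) + 1 / √(((n - k : ℕ) : ℝ) + 1)) := by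
    intro k hk
    have hk' : k ≤ n := by simpa [Nat.lt_succ_iff] using hk
    have hx : 0 < √((k : ℝ) + 1) := by positivity
    have hy : 0 < √(((n - k : ℕ) : ℝ) + 1) := by positivity
    have hxy : √((n : ℝ) + 1) ≤ √((k : ℝ) + 1) + √(((n - k : ℕ) : ℝ) + 1) := by
      rw [Real.sqrt_le_left (by positivity)]
      have e1 := Real.sq_sqrt (show (0 : ℝ) ≤ k + 1 by positivity)
      have e2 := Real.sq_sqrt (show (0 : ℝ) ≤ ((n - k : ℕ) : ℝ) + 1 by positivity)
      have e3 : ((n - k : ℕ) : ℝ) = n - k := Nat.cast_sub hk'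
      nlinarith [mul_pos hx hy]
    rw [div_mul_div_comm, one_mul, div_add_div _ _ hx.ne' hy.ne', div_mul_div_comm,
      div_le_div_iff₀ (by positivity) (by positivity)]
    nlinarith [mul_pos hx hy]
  have hrefl : ∑ k ∈ Finset.range (n + 1), 1 / √(((n - k : ℕ) : ℝ) + 1) =
      ∑ k ∈ Finset.range (n + 1), 1 / √((k : ℝ) + 1) := by
    have := Finset.sum_range_reflect (fun k : ℕ => 1 / √((k : ℝ) + 1)) (n + 1)
    simpa using this
  have hs := sum_inv_sqrt_le (n + 1)
  push_cast at hs
  refine (Finset.sum_le_sum hterm).trans ?_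
  rw [← Finset.mul_sum, Finset.sum_add_distrib, hrefl, one_div, inv_mul_le_iff₀ hN]
  linarith

/-- The weight `(1 + k²)^t` with values in `[0, ∞]`. -/
def jb (t : ℝ) (k : ℤ) : ENNReal := ENNReal.ofReal ((1 + (k : ℝ) ^ 2) ^ t)

lemma jb_mul_jb (t u : ℝ) (k : ℤ) : jb t k * jb u k = jb (t + u) k := by
  have h : 0 < 1 + (k : ℝ) ^ 2 := by positivity
  rw [jb, jb, jb, ← ENNReal.ofReal_mul (by positivity), ← Real.rpow_add h]

lemma jb_zero (k : ℤ) : jb 0 k = 1 := by simp [jb]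

lemma jb_neg (t : ℝ) (k : ℤ) : jb t (-k) = jb t k := by simp [jb]

lemma jb_sq (t : ℝ) (k : ℤ) : jb t k ^ 2 = jb (2 * t) k := by
  rw [pow_two, jb_mul_jb, two_mul]

lemma jb_quarter_le (k : ℕ) :
    (1 + ((k : ℤ) : ℝ) ^ 2) ^ (-1 / 4 : ℝ) ≤ √2 * (1 / √((k : ℝ) + 1)) := by
  have h0 : (0 : ℝ) < 1 + (k : ℝ) ^ 2 := by positivity
  have h1 : √((k : ℝ) + 1) ≤ √2 * (1 + (k : ℝ) ^ 2) ^ (1 / 4 : ℝ) := by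
    have : (1 + (k : ℝ) ^ 2) ^ (1 / 4 : ℝ) = √(√(1 + (k : ℝ) ^ 2)) := by
      rw [Real.sqrt_eq_rpow, Real.sqrt_eq_rpow, ← Real.rpow_mul h0.le]
      norm_num
    rw [this, ← Real.sqrt_mul (by norm_num)]
    apply Real.sqrt_le_sqrt
    have ha : (1 : ℝ) ≤ √(1 + (k : ℝ) ^ 2) := Real.one_le_sqrt.2 (by nlinarith [sq_nonneg (k : ℝ)])
    have hb : (k : ℝ) ≤ √(1 + (k : ℝ) ^ 2) := Real.le_sqrt_of_sq_le (by linarith)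
    linarith
  have h2 : 0 < √((k : ℝ) + 1) := by positivity
  rw [Int.cast_natCast, neg_div, Real.rpow_neg h0.le, ← mul_div_assoc, mul_one, le_div_iff₀ h2,
    inv_mul_le_iff₀ (by positivity), mul_comm]
  exact h1

lemma tsum_jb_quarter_nonneg_le (n : ℤ) :
    ∑' k : ℤ, (if 0 ≤ k ∧ 0 ≤ n - k then jb (-1 / 4) k * jb (-1 / 4) (n - k) else 0) ≤ 8 := by
  rcases lt_or_ge n 0 with hn | hn
  · rw [ENNReal.tsum_eq_zero.2]
    · positivity
    · intro k
      rw [if_neg (by omega)]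
  lift n to ℕ using hn
  rw [tsum_eq_sum (s := (Finset.range (n + 1)).map Nat.castEmbedding)]
  · rw [Finset.sum_map]
    have hterm : ∀ k ∈ Finset.range (n + 1),
        (if 0 ≤ (Nat.castEmbedding k : ℤ) ∧ 0 ≤ (n : ℤ) - Nat.castEmbedding k then
          jb (-1 / 4) (Nat.castEmbedding k) * jb (-1 / 4) (n - Nat.castEmbedding k) else 0) ≤
        ENNReal.ofReal (2 * (1 / √((k : ℝ) + 1) * (1 / √(((n - k : ℕ) : ℝ) + 1)))) := by
      intro k hk
      have hk' : k ≤ n := by simpa [Nat.lt_succ_iff] using hk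
      have e : (n : ℤ) - Nat.castEmbedding k = ((n - k : ℕ) : ℤ) := by
        simp [Nat.cast_sub hk']
      rw [e]
      simp only [Nat.castEmbedding_apply, Nat.cast_nonneg, and_self, if_true]
      rw [jb, jb, ← ENNReal.ofReal_mul (by positivity)]
      apply ENNReal.ofReal_le_ofReal
      refine (mul_le_mul (jb_quarter_le k) (jb_quarter_le (n - k)) (by positivity)
        (by positivity)).trans_eq ?_
      have := Real.mul_self_sqrt (show (0 : ℝ) ≤ 2 by norm_num)
      linear_combination (1 / √((k : ℝ) + 1) * (1 / √(((n - k : ℕ) : ℝ) + 1))) * this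
    refine (Finset.sum_le_sum hterm).trans ?_
    rw [← ENNReal.ofReal_sum_of_nonneg fun _ _ => by positivity, ← Finset.mul_sum]
    have := sum_inv_sqrt_mul_le n
    refine (ENNReal.ofReal_le_ofReal (show _ ≤ (8 : ℝ) by linarith)).trans_eq (by simp)
  · intro k hk
    rw [if_neg]
    rintro ⟨h1, h2⟩
    apply hk
    lift k to ℕ using h1
    simp only [Finset.mem_map, Finset.mem_range, Nat.castEmbedding_apply, Nat.cast_inj,
      exists_eq_right]
    omega

lemma tsum_jb_quarter_neg_le (n : ℤ) :
    ∑' k : ℤ, (if k < 0 ∧ n - k < 0 then jb (-1 / 4) k * jb (-1 / 4) (n - k) else 0) ≤ 8 := by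
  refine le_trans ?_ (tsum_jb_quarter_nonneg_le (-n))
  rw [← (Equiv.neg ℤ).tsum_eq]
  refine ENNReal.tsum_le_tsum fun k => ?_
  simp only [Equiv.neg_apply]
  have e : n - -k = -(-n - k) := by ring
  rw [e, jb_neg, jb_neg]
  split_ifs with h1 h2
  · rfl
  · omega
  · positivity
  · rfl

/-- `H^{1/4}(𝕋) ⊂ L⁴(𝕋)` for functions whose frequencies lie in a set `S` for which the
convolution of `(1 + k²)^{-1/4}` with itself, restricted to `S`, is bounded. -/
lemma lintegral_pow_four_le_of_support (S : ℤ → Prop) [DecidablePred S]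
    (hS : ∀ n : ℤ, ∑' k : ℤ, (if S k ∧ S (n - k) then jb (-1 / 4) k * jb (-1 / 4) (n - k) else 0)
      ≤ 8)
    {c : ℤ → ℂ} (hc : Summable fun k => ‖c k‖) (hcS : ∀ k, ¬ S k → c k = 0) :
    ∫⁻ x in I2pi, ‖∑' k, c k * e1 k x‖ₑ ^ 4 ≤
      ENNReal.ofReal (2 * π) * (8 * (∑' k, jb (1 / 4) k * ‖c k‖ₑ ^ 2) ^ 2) := by
  have hcc : Summable fun p : ℤ × ℤ => ‖c p.1 * c p.2‖ := hc.mul_norm hc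
  have hsq : ∀ x, ‖∑' k, c k * e1 k x‖ₑ ^ 4 =
      ‖∑' p : ℤ × ℤ, (c p.1 * c p.2) * e1 (p.1 + p.2) x‖ₑ ^ 2 := by
    intro x
    have hx : Summable fun k => ‖c k * e1 k x‖ := by simpa [norm_e1] using hc
    have h := tsum_mul_tsum_of_summable_norm hx hx
    have h2 : ∑' p : ℤ × ℤ, (c p.1 * c p.2) * e1 (p.1 + p.2) x =
        (∑' k, c k * e1 k x) * ∑' k, c k * e1 k x := by
      rw [h]
      refine tsum_congr fun p => ?_
      rw [e1_add]; ring
    rw [h2, enorm_mul]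
    ring
  simp only [hsq]
  refine (lintegral_sq_tsum_conv_le hcc).trans ?_
  gcongr
  have hn : ∀ n, (∑' m, ‖c m * c (n - m)‖ₑ) ^ 2 ≤
      8 * ∑' m, (jb (1 / 4) m * ‖c m‖ₑ ^ 2) * (jb (1 / 4) (n - m) * ‖c (n - m)‖ₑ ^ 2) := by
    intro n
    have h := tsum_mul_sq_le
      (fun m => if S m ∧ S (n - m) then jb (-1 / 8) m * jb (-1 / 8) (n - m) else 0)
      (fun m => (jb (1 / 8) m * ‖c m‖ₑ) * (jb (1 / 8) (n - m) * ‖c (n - m)‖ₑ))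
    have e1 : ∀ m, (if S m ∧ S (n - m) then jb (-1 / 8) m * jb (-1 / 8) (n - m) else 0) *
        ((jb (1 / 8) m * ‖c m‖ₑ) * (jb (1 / 8) (n - m) * ‖c (n - m)‖ₑ)) =
        ‖c m * c (n - m)‖ₑ := by
      intro m
      split_ifs with hm
      · have a : ∀ k, jb (-1 / 8) k * jb (1 / 8) k = 1 := fun k => by
          rw [jb_mul_jb]; norm_num [jb_zero]
        calc _ = (jb (-1 / 8) m * jb (1 / 8) m) * (jb (-1 / 8) (n - m) * jb (1 / 8) (n - m)) *
              (‖c m‖ₑ * ‖c (n - m)‖ₑ) := by ring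
          _ = _ := by rw [a, a, enorm_mul, one_mul, one_mul]
      · rw [not_and_or] at hm
        rcases hm with hm | hm <;> simp [hcS _ hm]
    have e2 : ∀ m, (if S m ∧ S (n - m) then jb (-1 / 8) m * jb (-1 / 8) (n - m) else 0) ^ 2 =
        if S m ∧ S (n - m) then jb (-1 / 4) m * jb (-1 / 4) (n - m) else 0 := by
      intro m
      split_ifs
      · rw [mul_pow, jb_sq, jb_sq]; norm_num
      · simp
    simp only [e1, e2] at h
    refine h.trans (mul_le_mul' (hS n) (ENNReal.tsum_le_tsum fun m => le_of_eq ?_))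
    simp only [mul_pow, jb_sq]
    norm_num
  refine (ENNReal.tsum_le_tsum hn).trans_eq ?_
  rw [ENNReal.tsum_mul_left, ENNReal.tsum_comm]
  congr 1
  simp only [ENNReal.tsum_mul_left]
  have hsub' : ∀ m : ℤ, ∑' n, jb (1 / 4) (n - m) * ‖c (n - m)‖ₑ ^ 2 =
      ∑' l, jb (1 / 4) l * ‖c l‖ₑ ^ 2 := fun m =>
    (Equiv.subRight m).tsum_eq fun l => jb (1 / 4) l * ‖c l‖ₑ ^ 2
  simp only [hsub']
  rw [ENNReal.tsum_mul_right, ← pow_two]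

/-- The critical Sobolev embedding `H^{1/4}(𝕋) ⊂ L⁴(𝕋)`. -/
lemma lintegral_pow_four_le {c : ℤ → ℂ} (hc : Summable fun k => ‖c k‖) :
    ∫⁻ x in I2pi, ‖∑' k, c k * e1 k x‖ₑ ^ 4 ≤
      (32 * ∑' k, jb (1 / 4) k * ‖c k‖ₑ ^ 2) ^ 2 := by
  set cp : ℤ → ℂ := fun k => if 0 ≤ k then c k else 0 with hcp
  set cm : ℤ → ℂ := fun k => if k < 0 then c k else 0 with hcm
  have ncp : ∀ k, ‖cp k‖ ≤ ‖c k‖ := fun k => by simp only [hcp]; split_ifs <;> simp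
  have ncm : ∀ k, ‖cm k‖ ≤ ‖c k‖ := fun k => by simp only [hcm]; split_ifs <;> simp
  have sp : Summable fun k => ‖cp k‖ := hc.of_nonneg_of_le (fun _ => norm_nonneg _) ncp
  have sm : Summable fun k => ‖cm k‖ := hc.of_nonneg_of_le (fun _ => norm_nonneg _) ncm
  have hp := lintegral_pow_four_le_of_support (fun k => 0 ≤ k) tsum_jb_quarter_nonneg_le sp
    fun k hk => by simp [hcp, hk]
  have hm := lintegral_pow_four_le_of_support (fun k => k < 0) tsum_jb_quarter_neg_le sm
    fun k hk => by simp only [hcm, hk, if_false]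
  have hsplit : ∀ x, ∑' k, c k * e1 k x = ∑' k, cp k * e1 k x + ∑' k, cm k * e1 k x := by
    intro x
    rw [← Summable.tsum_add]
    · refine tsum_congr fun k => ?_
      simp only [hcp, hcm]
      rcases lt_or_ge k 0 with h | h
      · simp [h, not_le.2 h]
      · simp [h, not_lt.2 h]
    · exact Summable.of_norm (by simpa [norm_e1] using sp)
    · exact Summable.of_norm (by simpa [norm_e1] using sm)
  have hpt : ∀ x, ‖∑' k, c k * e1 k x‖ₑ ^ 4 ≤
      8 * (‖∑' k, cp k * e1 k x‖ₑ ^ 4 + ‖∑' k, cm k * e1 k x‖ₑ ^ 4) := by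
    intro x
    rw [hsplit]
    refine (pow_le_pow_left' (enorm_add_le _ _) 4).trans ?_
    have := ENNReal.rpow_add_le_mul_rpow_add_rpow ‖∑' k, cp k * e1 k x‖ₑ ‖∑' k, cm k * e1 k x‖ₑ
      (p := 4) (by norm_num)
    rw [show (4 : ℝ) - 1 = (3 : ℕ) by norm_num, show (4 : ℝ) = (4 : ℕ) by norm_num] at this
    simp only [ENNReal.rpow_natCast] at this
    norm_num at this
    exact this
  have meas : ∀ {d : ℤ → ℂ}, Summable (fun k => ‖d k‖) →
      Measurable fun x => ‖∑' k, d k * e1 k x‖ₑ ^ 4 := by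
    intro d hd
    have : Continuous fun x => ∑' k, d k * e1 k x :=
      continuous_tsum (fun n => continuous_const.mul (continuous_e1 n)) hd
        fun n x => by simp [norm_e1]
    exact (this.enorm.measurable).pow_const 4
  have mono : ∀ {d : ℤ → ℂ}, (∀ k, ‖d k‖ ≤ ‖c k‖) →
      ∑' k, jb (1 / 4) k * ‖d k‖ₑ ^ 2 ≤ ∑' k, jb (1 / 4) k * ‖c k‖ₑ ^ 2 := by
    intro d hd
    refine ENNReal.tsum_le_tsum fun k => ?_
    gcongr
    exact enorm_le_iff_norm_le.2 (hd k)
  refine (lintegral_mono hpt).trans ?_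
  rw [lintegral_const_mul' _ _ (by norm_num), lintegral_add_left (meas sp)]
  set B := ∑' k, jb (1 / 4) k * ‖c k‖ₑ ^ 2
  have h1 := hp.trans (mul_le_mul' le_rfl (mul_le_mul' le_rfl (pow_le_pow_left' (mono ncp) 2)))
  have h2 := hm.trans (mul_le_mul' le_rfl (mul_le_mul' le_rfl (pow_le_pow_left' (mono ncm) 2)))
  refine (mul_le_mul' le_rfl (add_le_add h1 h2)).trans ?_
  have h8 : ENNReal.ofReal (2 * π) ≤ 8 :=
    (ENNReal.ofReal_le_ofReal (show 2 * π ≤ 8 by linarith [Real.pi_le_four])).trans_eq (by simp)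
  calc 8 * (ENNReal.ofReal (2 * π) * (8 * B ^ 2) + ENNReal.ofReal (2 * π) * (8 * B ^ 2))
      ≤ 8 * (8 * (8 * B ^ 2) + 8 * (8 * B ^ 2)) := by gcongr
    _ = (32 * B) ^ 2 := by ring

section Dyadic

variable {χ θ : ℝ → ℝ}

lemma blockSymb_nonneg (hp : IsDyadicPartition χ θ) (j : ℤ) (z : ℝ) : 0 ≤ blockSymb χ θ j z := by
  unfold blockSymb
  split_ifs
  exacts [hp.nonneg_chi _, hp.nonneg_theta _, le_rfl]

/-- The `j`-th block lives at frequencies comparable to `2^j`. -/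
lemma exists_blockSymb_support (hp : IsDyadicPartition χ θ) :
    ∃ C : ℝ, 1 ≤ C ∧ ∀ (j : ℤ) (z : ℝ), blockSymb χ θ j z ≠ 0 →
      -1 ≤ j ∧ (2 : ℝ) ^ j ≤ C * (1 + |z|) ∧ |z| ≤ C * (2 : ℝ) ^ j := by
  obtain ⟨R₀, hR₀, hχ⟩ := hp.chi_support
  obtain ⟨r, R, hr, hrR, hθ⟩ := hp.theta_support
  have hR : 0 < R := hr.trans hrR
  refine ⟨1 + 2 * R₀ + r⁻¹ + R, by linarith [inv_pos.2 hr], fun j z hj => ?_⟩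
  have hz := abs_nonneg z
  have hri := inv_pos.2 hr
  unfold blockSymb at hj
  split_ifs at hj with h1 h2
  · subst h1
    have : |z| < R₀ := by
      by_contra h
      exact hj (hχ _ (by rw [abs_abs]; linarith))
    refine ⟨le_rfl, ?_, ?_⟩
    · rw [zpow_neg_one]; nlinarith
    · rw [zpow_neg_one]; linarith
  · have h2j : (0 : ℝ) < 2 ^ j := by positivity
    have hab : abs ((2 : ℝ) ^ (-j) * |z|) = |z| / 2 ^ j := by
      rw [abs_of_nonneg (by positivity), zpow_neg]; ring
    have hn := mt (hθ ((2 : ℝ) ^ (-j) * |z|)) hj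
    rw [not_or, not_lt, not_lt, hab, le_div_iff₀ h2j, div_le_iff₀ h2j] at hn
    refine ⟨by omega, ?_, ?_⟩
    · have : (2 : ℝ) ^ j ≤ r⁻¹ * |z| := by
        rw [le_inv_mul_iff₀ hr]; exact hn.1
      nlinarith
    · nlinarith [hn.2]
  · exact absurd hj (by simp)

lemma hasSum_blockSymb (hp : IsDyadicPartition χ θ) (z : ℝ) :
    HasSum (fun j : ℤ => blockSymb χ θ j z) 1 := by
  obtain ⟨C, hC, hsupp⟩ := exists_blockSymb_support hp
  obtain ⟨N, hN⟩ := pow_unbounded_of_one_lt (C * (1 + |z|)) (one_lt_two)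
  have hfin : (Function.support fun j : ℤ => blockSymb χ θ j z).Finite := by
    refine (Set.finite_Icc (-1 : ℤ) N).subset fun j hj => ?_
    obtain ⟨h1, h2, -⟩ := hsupp j z hj
    refine ⟨h1, ?_⟩
    have : (2 : ℝ) ^ j < 2 ^ (N : ℤ) := by rw [zpow_natCast]; linarith
    exact ((zpow_lt_zpow_iff_right₀ one_lt_two).1 this).le
  have hs : Summable fun j : ℤ => blockSymb χ θ j z := summable_of_hasFiniteSupport hfin
  rw [hs.hasSum_iff]
  have hs1 : Summable fun n : ℕ => blockSymb χ θ (n : ℤ) z :=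
    hs.comp_injective (i := fun n : ℕ => (n : ℤ)) Nat.cast_injective
  have hs2 : Summable fun n : ℕ => blockSymb χ θ (-((n : ℤ) + 1)) z :=
    hs.comp_injective (i := fun n : ℕ => -((n : ℤ) + 1)) fun a b h => by simpa using h
  rw [tsum_of_nat_of_neg_add_one (f := fun j : ℤ => blockSymb χ θ j z) hs1 hs2]
  have h1 : ∑' n : ℕ, blockSymb χ θ (-((n : ℤ) + 1)) z = χ |z| := by
    rw [tsum_eq_single 0]
    · simp [blockSymb]
    · intro n hn
      unfold blockSymb
      rw [if_neg (by omega), if_neg (by omega)]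
  have h2 : ∀ n : ℕ, blockSymb χ θ (n : ℤ) z = θ ((2 : ℝ) ^ (-(n : ℤ)) * |z|) := by
    intro n
    unfold blockSymb
    rw [if_neg (by omega), if_pos (by omega)]
  rw [h1]
  simp only [h2]
  rw [add_comm]
  exact hp.partition |z|

lemma blockSymb_le_one (hp : IsDyadicPartition χ θ) (j : ℤ) (z : ℝ) : blockSymb χ θ j z ≤ 1 :=
  le_hasSum (hasSum_blockSymb hp z) j fun i _ => blockSymb_nonneg hp i z

/-- The symbol of the vertical remainder. -/
def remSymb (χ θ : ℝ → ℝ) (m l : ℤ) : ℝ :=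
  ∑' p : ℤ × ℤ, if |p.1 - p.2| ≤ 1 then blockSymb χ θ p.1 m * blockSymb χ θ p.2 l else 0

lemma summable_blockSymb_mul (hp : IsDyadicPartition χ θ) (z w : ℝ) :
    Summable fun p : ℤ × ℤ => blockSymb χ θ p.1 z * blockSymb χ θ p.2 w :=
  Summable.mul_of_nonneg (f := fun j : ℤ => blockSymb χ θ j z)
    (g := fun j : ℤ => blockSymb χ θ j w) (hasSum_blockSymb hp z).summable
    (hasSum_blockSymb hp w).summable (Pi.le_def.2 fun j => blockSymb_nonneg hp j z)
    (Pi.le_def.2 fun j => blockSymb_nonneg hp j w)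

lemma remSymb_nonneg (hp : IsDyadicPartition χ θ) (m l : ℤ) : 0 ≤ remSymb χ θ m l := by
  refine tsum_nonneg fun p => ?_
  split_ifs
  exacts [mul_nonneg (blockSymb_nonneg hp _ _) (blockSymb_nonneg hp _ _), le_rfl]

lemma remSymb_le_one (hp : IsDyadicPartition χ θ) (m l : ℤ) : remSymb χ θ m l ≤ 1 := by
  have hs := summable_blockSymb_mul hp (m : ℝ) (l : ℝ)
  have h0 : ∀ p : ℤ × ℤ, 0 ≤ blockSymb χ θ p.1 m * blockSymb χ θ p.2 l := fun p =>
    mul_nonneg (blockSymb_nonneg hp _ _) (blockSymb_nonneg hp _ _)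
  have h1 : ∀ p : ℤ × ℤ, (if |p.1 - p.2| ≤ 1 then blockSymb χ θ p.1 m * blockSymb χ θ p.2 l
      else 0) ≤ blockSymb χ θ p.1 m * blockSymb χ θ p.2 l := fun p => by
    split_ifs
    exacts [le_rfl, h0 p]
  have h2 : ∀ p : ℤ × ℤ, 0 ≤ (if |p.1 - p.2| ≤ 1 then blockSymb χ θ p.1 m * blockSymb χ θ p.2 l
      else 0) := fun p => by
    split_ifs
    exacts [h0 p, le_rfl]
  refine ((hs.of_nonneg_of_le h2 h1).tsum_le_tsum h1 hs).trans ?_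
  rw [← (hasSum_blockSymb hp m).summable.tsum_mul_tsum (hasSum_blockSymb hp l).summable hs,
    (hasSum_blockSymb hp m).tsum_eq, (hasSum_blockSymb hp l).tsum_eq, one_mul]

lemma exists_remSymb_support (hp : IsDyadicPartition χ θ) :
    ∃ D : ℝ, 1 ≤ D ∧ ∀ m l : ℤ, remSymb χ θ m l ≠ 0 →
      1 + ((m + l : ℤ) : ℝ) ^ 2 ≤ D * (1 + (m : ℝ) ^ 2) := by
  obtain ⟨C, hC, hsupp⟩ := exists_blockSymb_support hp
  refine ⟨1 + 2 * (1 + 2 * C ^ 2) ^ 2, by nlinarith [sq_nonneg (1 + 2 * C ^ 2)], fun m l h => ?_⟩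
  have : ∃ p : ℤ × ℤ, (if |p.1 - p.2| ≤ 1 then blockSymb χ θ p.1 m * blockSymb χ θ p.2 l
      else 0) ≠ 0 := by
    by_contra hcon
    push Not at hcon
    exact h (by simp only [remSymb, hcon, tsum_zero])
  obtain ⟨⟨j, j'⟩, hjj⟩ := this
  simp only [ne_eq, ite_eq_right_iff, mul_eq_zero, not_forall, not_or] at hjj
  obtain ⟨hd, h1, h2⟩ := hjj
  obtain ⟨-, h3, -⟩ := hsupp _ _ h1
  obtain ⟨-, -, h4⟩ := hsupp _ _ h2
  have h5 : (2 : ℝ) ^ j' ≤ 2 * 2 ^ j := by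
    rw [← zpow_one_add₀ two_ne_zero]
    exact zpow_le_zpow_right₀ one_le_two (by rw [abs_le] at hd; omega)
  have h6 : |(l : ℝ)| ≤ 2 * C ^ 2 * (1 + |(m : ℝ)|) := by
    have : C * (2 : ℝ) ^ j' ≤ C * (2 * (C * (1 + |(m : ℝ)|))) := by gcongr; linarith
    linarith
  have h7 : |((m + l : ℤ) : ℝ)| ≤ (1 + 2 * C ^ 2) * (1 + |(m : ℝ)|) := by
    push_cast
    linarith [abs_add_le (m : ℝ) l]
  have h8 := pow_le_pow_left₀ (abs_nonneg _) h7 2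
  rw [sq_abs, mul_pow] at h8
  have h9 : (1 + |(m : ℝ)|) ^ 2 ≤ 2 * (1 + (m : ℝ) ^ 2) := by
    nlinarith [sq_nonneg (1 - |(m : ℝ)|), sq_abs (m : ℝ)]
  nlinarith [sq_nonneg (1 + 2 * C ^ 2), sq_nonneg (m : ℝ)]

lemma exists_tsum_blockSymb_sq_le (hp : IsDyadicPartition χ θ) {s : ℝ} (hs : 0 ≤ s) :
    ∃ K : ℝ, 0 < K ∧ ∀ n : ℤ, ∑' j : ℤ, ENNReal.ofReal ((2 : ℝ) ^ (2 * (j : ℝ) * s)) *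
      ENNReal.ofReal (blockSymb χ θ j n) ^ 2 ≤ ENNReal.ofReal K * jb s n := by
  obtain ⟨C, hC, hsupp⟩ := exists_blockSymb_support hp
  refine ⟨(2 * C ^ 2) ^ s, by positivity, fun n => ?_⟩
  have key : ∀ j : ℤ, ENNReal.ofReal ((2 : ℝ) ^ (2 * (j : ℝ) * s)) *
      ENNReal.ofReal (blockSymb χ θ j n) ^ 2 ≤
      ENNReal.ofReal ((2 * C ^ 2) ^ s * (1 + (n : ℝ) ^ 2) ^ s) *
        ENNReal.ofReal (blockSymb χ θ j n) := by
    intro j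
    by_cases h0 : blockSymb χ θ j n = 0
    · simp [h0]
    obtain ⟨-, h1, -⟩ := hsupp _ _ h0
    rw [pow_two]
    refine mul_le_mul' (ENNReal.ofReal_le_ofReal ?_) ?_
    · rw [← Real.mul_rpow (by positivity) (by positivity), Real.rpow_mul (by norm_num)]
      refine Real.rpow_le_rpow (by positivity) ?_ hs
      rw [mul_comm, Real.rpow_mul (by norm_num), Real.rpow_intCast, Real.rpow_two]
      refine (pow_le_pow_left₀ (by positivity) h1 2).trans ?_
      have h9 : (1 + |(n : ℝ)|) ^ 2 ≤ 2 * (1 + (n : ℝ) ^ 2) := by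
        nlinarith [sq_nonneg (1 - |(n : ℝ)|), sq_abs (n : ℝ)]
      rw [mul_pow]
      nlinarith [sq_nonneg C]
    · refine mul_le_of_le_one_right zero_le ?_
      exact ENNReal.ofReal_le_one.2 (blockSymb_le_one hp _ _)
  refine (ENNReal.tsum_le_tsum key).trans ?_
  rw [ENNReal.tsum_mul_left, ← ENNReal.ofReal_tsum_of_nonneg (fun j => blockSymb_nonneg hp j n)
    (hasSum_blockSymb hp n).summable, (hasSum_blockSymb hp n).tsum_eq, ENNReal.ofReal_one, mul_one,
    ENNReal.ofReal_mul (by positivity), jb]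

end Dyadic

section Decay

variable {f : ℝ × ℝ → ℝ}

lemma Smooth.fderiv_apply (hf : Smooth f) (v : ℝ × ℝ) : Smooth fun x => fderiv ℝ f x v := by
  unfold Smooth at *
  exact (hf.fderiv_right (m := (⊤ : ℕ∞)) (by simp)).clm_apply contDiff_const

lemma Smooth.pd1 (hf : Smooth f) : Smooth (pd1 f) := hf.fderiv_apply _

lemma Smooth.pd2 (hf : Smooth f) : Smooth (pd2 f) := hf.fderiv_apply _

lemma Per.fderiv_apply (hf : Per f) (v : ℝ × ℝ) : Per fun x => fderiv ℝ f x v := by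
  have h1 : (fun x : ℝ × ℝ => f (x + (2 * π, 0))) = f := by
    ext x
    have e : x + (2 * π, 0) = (x.1 + 2 * π, x.2) := by ext <;> simp
    rw [e, hf.1 x]
  have h2 : (fun x : ℝ × ℝ => f (x + (0, 2 * π))) = f := by
    ext x
    have e : x + (0, 2 * π) = (x.1, x.2 + 2 * π) := by ext <;> simp
    rw [e, hf.2 x]
  constructor
  · intro x
    have := fderiv_comp_add_right (𝕜 := ℝ) (f := f) (x := x) (2 * π, 0)
    rw [h1] at this
    have e : x + (2 * π, 0) = (x.1 + 2 * π, x.2) := by ext <;> simp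
    rw [e] at this
    simp only [this]
  · intro x
    have := fderiv_comp_add_right (𝕜 := ℝ) (f := f) (x := x) (0, 2 * π)
    rw [h2] at this
    have e : x + (0, 2 * π) = (x.1, x.2 + 2 * π) := by ext <;> simp
    rw [e] at this
    simp only [this]

lemma Per.pd1 (hf : Per f) : Per (pd1 f) := hf.fderiv_apply _

lemma Per.pd2 (hf : Per f) : Per (pd2 f) := hf.fderiv_apply _

lemma integral_deriv_mul_e1 {h h' : ℝ → ℝ} (hd : ∀ x, HasDerivAt h (h' x) x)
    (hc : Continuous h') (hp : h (2 * π) = h 0) (n : ℤ) :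
    ∫ x in I2pi, (h' x : ℂ) * e1 (-n) x = Complex.I * n * ∫ x in I2pi, (h x : ℂ) * e1 (-n) x := by
  have h2 : (0 : ℝ) ≤ 2 * π := by positivity
  have he : ∀ x, HasDerivAt (e1 (-n)) (-(Complex.I * n) * e1 (-n) x) x := by
    intro x
    have h0 : HasDerivAt (fun y : ℝ => (y : ℂ)) 1 x := Complex.ofRealCLM.hasDerivAt
    have h1 := ((h0.const_mul ((-n : ℤ) : ℂ)).const_mul Complex.I).cexp
    refine h1.congr_deriv ?_
    simp only [e1]
    push_cast
    ring
  have hcont : Continuous h := continuous_iff_continuousAt.2 fun x => (hd x).continuousAt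
  rw [I2pi, ← intervalIntegral.integral_of_le h2, ← intervalIntegral.integral_of_le h2]
  have hparts := intervalIntegral.integral_mul_deriv_eq_deriv_mul (a := 0) (b := 2 * π)
    (u := e1 (-n)) (u' := fun x => -(Complex.I * n) * e1 (-n) x)
    (v := fun x => (h x : ℂ)) (v' := fun x => (h' x : ℂ))
    (fun x _ => he x) (fun x _ => (hd x).ofReal_comp)
    ((continuous_const.mul (continuous_e1 _)).intervalIntegrable _ _)
    ((Complex.continuous_ofReal.comp hc).intervalIntegrable _ _)
  have hper : e1 (-n) (2 * π) = e1 (-n) 0 := by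
    have h1 : Complex.I * (((-n : ℤ) : ℂ) * ((2 * π : ℝ) : ℂ)) =
        ((-n : ℤ) : ℂ) * (2 * π * Complex.I) := by
      push_cast; ring
    rw [e1, h1, Complex.exp_int_mul_two_pi_mul_I]
    simp [e1]
  rw [hp, hper, sub_self, zero_sub] at hparts
  simp only [mul_comm (Complex.ofReal _) (e1 _ _)]
  rw [hparts, ← intervalIntegral.integral_neg, ← intervalIntegral.integral_const_mul]
  congr 1
  ext x
  ring

lemma integrable_mul_eK (hf : Continuous f) (k : ℤ × ℤ) :
    Integrable (fun x => (f x : ℂ) * eK k x) ((volume : Measure (ℝ × ℝ)).restrict Q2) := by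
  have hc : Continuous fun x => (f x : ℂ) * eK k x :=
    (Complex.continuous_ofReal.comp hf).mul (continuous_eK k)
  refine (hc.continuousOn.integrableOn_compact
    ((isCompact_Icc (a := (0 : ℝ)) (b := 2 * π)).prod (isCompact_Icc (a := (0 : ℝ)) (b := 2 * π)))
    ).mono_set ?_
  exact Set.prod_mono Ioc_subset_Icc_self Ioc_subset_Icc_self

lemma hasDerivAt_fst (hf : Smooth f) (x y : ℝ) :
    HasDerivAt (fun t => f (t, y)) (pd1 f (x, y)) x := by
  have h : HasFDerivAt f (fderiv ℝ f (x, y)) (x, y) :=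
    ((ContDiff.differentiable hf (by simp)) (x, y)).hasFDerivAt
  exact h.comp_hasDerivAt x ((hasDerivAt_id x).prodMk (hasDerivAt_const x y))

lemma hasDerivAt_snd (hf : Smooth f) (x y : ℝ) :
    HasDerivAt (fun t => f (x, t)) (pd2 f (x, y)) y := by
  have h : HasFDerivAt f (fderiv ℝ f (x, y)) (x, y) :=
    ((ContDiff.differentiable hf (by simp)) (x, y)).hasFDerivAt
  exact h.comp_hasDerivAt y ((hasDerivAt_const y x).prodMk (hasDerivAt_id y))

lemma fc_eq_integral_symm (hf : Continuous f) (k : ℤ × ℤ) :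
    fc f k = (1 / (2 * π) ^ 2 : ℂ) * ∫ y in I2pi, e1 (-k.2) y *
      ∫ x in I2pi, (f (x, y) : ℂ) * e1 (-k.1) x := by
  have hi := integrable_mul_eK hf (-k)
  rw [fc, fcC_eq]
  rw [restrict_Q2] at hi ⊢
  rw [integral_prod_symm _ hi]
  congr 2
  ext y
  rw [← integral_const_mul]
  congr 1
  ext x
  simp only [eK_eq, Prod.fst_neg, Prod.snd_neg]
  ring

lemma fc_eq_integral (hf : Continuous f) (k : ℤ × ℤ) :
    fc f k = (1 / (2 * π) ^ 2 : ℂ) * ∫ x in I2pi, e1 (-k.1) x *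
      ∫ y in I2pi, (f (x, y) : ℂ) * e1 (-k.2) y := by
  have hi := integrable_mul_eK hf (-k)
  rw [fc, fcC_eq]
  rw [restrict_Q2] at hi ⊢
  rw [integral_prod _ hi]
  congr 2
  ext x
  rw [← integral_const_mul]
  congr 1
  ext y
  simp only [eK_eq, Prod.fst_neg, Prod.snd_neg]
  ring

lemma fc_pd1 (hf : Smooth f) (hp : Per f) (k : ℤ × ℤ) :
    fc (pd1 f) k = Complex.I * k.1 * fc f k := by
  rw [fc_eq_integral_symm hf.pd1.continuous, fc_eq_integral_symm hf.continuous]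
  have : ∀ y, ∫ x in I2pi, (pd1 f (x, y) : ℂ) * e1 (-k.1) x =
      Complex.I * k.1 * ∫ x in I2pi, (f (x, y) : ℂ) * e1 (-k.1) x := fun y =>
    integral_deriv_mul_e1 (h := fun x => f (x, y)) (fun x => hasDerivAt_fst hf x y)
      (hf.pd1.continuous.comp (by fun_prop)) (by simpa using hp.1 (0, y)) _
  simp only [this, mul_left_comm (e1 _ _) (Complex.I * _), integral_const_mul]
  ring

lemma fc_pd2 (hf : Smooth f) (hp : Per f) (k : ℤ × ℤ) :
    fc (pd2 f) k = Complex.I * k.2 * fc f k := by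
  rw [fc_eq_integral hf.pd2.continuous, fc_eq_integral hf.continuous]
  have : ∀ x, ∫ y in I2pi, (pd2 f (x, y) : ℂ) * e1 (-k.2) y =
      Complex.I * k.2 * ∫ y in I2pi, (f (x, y) : ℂ) * e1 (-k.2) y := fun x =>
    integral_deriv_mul_e1 (h := fun y => f (x, y)) (fun y => hasDerivAt_snd hf x y)
      (hf.pd2.continuous.comp (by fun_prop)) (by simpa using hp.2 (x, 0)) _
  simp only [this, mul_left_comm (e1 _ _) (Complex.I * _), integral_const_mul]
  ring

lemma fc_sub {g : ℝ × ℝ → ℝ} (hf : Continuous f) (hg : Continuous g) (k : ℤ × ℤ) :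
    fc (fun x => f x - g x) k = fc f k - fc g k := by
  simp only [fc, fcC_eq, Complex.ofReal_sub, sub_mul]
  rw [integral_sub (integrable_mul_eK hf _) (integrable_mul_eK hg _), mul_sub]

lemma Per.sub {g : ℝ × ℝ → ℝ} (hf : Per f) (hg : Per g) : Per fun x => f x - g x :=
  ⟨fun x => by simp only [hf.1 x, hg.1 x], fun x => by simp only [hf.2 x, hg.2 x]⟩

lemma exists_fc_eq (hf : Smooth f) (hp : Per f) (N M : ℕ) :
    ∃ h : ℝ × ℝ → ℝ, Smooth h ∧ Per h ∧
      ∀ k, fc h k = (1 + (k.1 : ℂ) ^ 2) ^ N * (1 + (k.2 : ℂ) ^ 2) ^ M * fc f k := by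
  induction N with
  | zero =>
    induction M with
    | zero => exact ⟨f, hf, hp, fun k => by simp⟩
    | succ M ih =>
      obtain ⟨h, h1, h2, h3⟩ := ih
      refine ⟨fun x => h x - pd2 (pd2 h) x, h1.sub h1.pd2.pd2, h2.sub h2.pd2.pd2, fun k => ?_⟩
      rw [fc_sub h1.continuous h1.pd2.pd2.continuous, fc_pd2 h1.pd2 h2.pd2, fc_pd2 h1 h2, h3]
      linear_combination (-(k.2 : ℂ) ^ 2 * ((1 + (k.1 : ℂ) ^ 2) ^ 0 * (1 + (k.2 : ℂ) ^ 2) ^ M *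
        fc f k)) * Complex.I_sq
  | succ N ih =>
    obtain ⟨h, h1, h2, h3⟩ := ih
    refine ⟨fun x => h x - pd1 (pd1 h) x, h1.sub h1.pd1.pd1, h2.sub h2.pd1.pd1, fun k => ?_⟩
    rw [fc_sub h1.continuous h1.pd1.pd1.continuous, fc_pd1 h1.pd1 h2.pd1, fc_pd1 h1 h2, h3]
    linear_combination (-(k.1 : ℂ) ^ 2 * ((1 + (k.1 : ℂ) ^ 2) ^ N * (1 + (k.2 : ℂ) ^ 2) ^ M *
      fc f k)) * Complex.I_sq

lemma exists_norm_fc_le (f : ℝ × ℝ → ℝ) : ∃ C, ∀ k, ‖fc f k‖ ≤ C := by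
  refine ⟨‖(1 / (2 * π) ^ 2 : ℂ)‖ * ∫ x in Q2, ‖(f x : ℂ)‖, fun k => ?_⟩
  rw [fc, fcC_eq, norm_mul]
  gcongr
  refine (norm_integral_le_integral_norm _).trans_eq ?_
  simp [norm_eK]

/-- Rapid decay of the Fourier coefficients of a smooth function on the torus. -/
lemma exists_norm_fc_mul_le (hf : Smooth f) (hp : Per f) (N : ℕ) :
    ∃ C, 0 ≤ C ∧ ∀ k : ℤ × ℤ,
      (1 + (k.1 : ℝ) ^ 2) ^ N * (1 + (k.2 : ℝ) ^ 2) ^ N * ‖fc f k‖ ≤ C := by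
  obtain ⟨h, -, -, h3⟩ := exists_fc_eq hf hp N N
  obtain ⟨C, hC⟩ := exists_norm_fc_le h
  refine ⟨C, (norm_nonneg _).trans (hC 0), fun k => ?_⟩
  refine le_trans (le_of_eq ?_) (hC k)
  rw [h3, norm_mul, norm_mul, norm_pow, norm_pow]
  have : ∀ n : ℤ, ‖1 + (n : ℂ) ^ 2‖ = 1 + (n : ℝ) ^ 2 := by
    intro n
    have e : (1 + (n : ℂ) ^ 2) = ((1 + (n : ℝ) ^ 2 : ℝ) : ℂ) := by push_cast; rfl
    rw [e, Complex.norm_real, Real.norm_of_nonneg (by positivity)]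
  rw [this, this]

lemma summable_jb {t : ℝ} (ht : 1 / 2 < t) : Summable fun n : ℤ => (1 + (n : ℝ) ^ 2) ^ (-t) := by
  have h := (Real.summable_abs_int_rpow (b := 2 * t) (by linarith))
  refine summable_of_isBigO h (Asymptotics.IsBigO.of_bound 1 ?_)
  filter_upwards [(Set.finite_singleton (0 : ℤ)).compl_mem_cofinite] with n hn
  have hn0 : (0 : ℝ) < |(n : ℝ)| := by simpa using hn
  rw [one_mul, Real.norm_of_nonneg (by positivity), Real.norm_of_nonneg (by positivity)]
  rw [show -(2 * t) = 2 * -t by ring, Real.rpow_mul (abs_nonneg _), Real.rpow_two, sq_abs]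
  exact Real.rpow_le_rpow_of_nonpos (by rw [← sq_abs]; positivity) (by linarith) (by linarith)

lemma summable_prod_inv :
    Summable fun k : ℤ × ℤ => ((1 + (k.1 : ℝ) ^ 2) * (1 + (k.2 : ℝ) ^ 2))⁻¹ := by
  have h := summable_jb (t := 1) (by norm_num)
  simp only [Real.rpow_neg_one] at h
  refine (h.mul_of_nonneg h (Pi.le_def.2 fun _ => ?_) (Pi.le_def.2 fun _ => ?_)).congr fun k => ?_
  · simp only [Pi.zero_apply]; positivity
  · simp only [Pi.zero_apply]; positivity
  · rw [mul_inv]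

lemma summable_norm_fc (hf : Smooth f) (hp : Per f) : Summable fun k => ‖fc f k‖ := by
  obtain ⟨C, hC0, hC⟩ := exists_norm_fc_mul_le hf hp 1
  refine (summable_prod_inv.mul_left C).of_nonneg_of_le (fun _ => norm_nonneg _) fun k => ?_
  have := hC k
  rw [pow_one, pow_one] at this
  rw [← div_eq_mul_inv, le_div_iff₀ (by positivity)]
  linarith

lemma summable_aw_mul_fc_sq (hf : Smooth f) (hp : Per f) (s t : ℝ) :
    Summable fun k => aw s t k * ‖fc f k‖ ^ 2 := by
  obtain ⟨N, hN⟩ := exists_nat_ge (max s t)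
  obtain ⟨C, hC0, hC⟩ := exists_norm_fc_mul_le hf hp (N + 1)
  refine (summable_prod_inv.mul_left (C ^ 2)).of_nonneg_of_le
    (fun k => by unfold aw; positivity) fun k => ?_
  have hk := hC k
  have h1 : (1 : ℝ) ≤ 1 + (k.1 : ℝ) ^ 2 := by linarith [sq_nonneg (k.1 : ℝ)]
  have h2 : (1 : ℝ) ≤ 1 + (k.2 : ℝ) ^ 2 := by linarith [sq_nonneg (k.2 : ℝ)]
  set A := 1 + (k.1 : ℝ) ^ 2
  set B := 1 + (k.2 : ℝ) ^ 2
  have hA : A ^ s ≤ A ^ N := by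
    rw [← Real.rpow_natCast]
    exact Real.rpow_le_rpow_of_exponent_le h1 ((le_max_left _ _).trans hN)
  have hB : B ^ t ≤ B ^ N := by
    rw [← Real.rpow_natCast]
    exact Real.rpow_le_rpow_of_exponent_le h2 ((le_max_right _ _).trans hN)
  have hsq := pow_le_pow_left₀ (by positivity) hk 2
  rw [← div_eq_mul_inv, le_div_iff₀ (by positivity)]
  refine le_trans ?_ hsq
  have hAN : 1 ≤ A ^ (N + 1) := one_le_pow₀ h1
  have hBN : 1 ≤ B ^ (N + 1) := one_le_pow₀ h2
  calc aw s t k * ‖fc f k‖ ^ 2 * (A * B)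
      ≤ (A ^ N * B ^ N) * ‖fc f k‖ ^ 2 * (A * B) := by
        unfold aw; gcongr
    _ = (A ^ (N + 1) * B ^ (N + 1)) * ‖fc f k‖ ^ 2 := by ring
    _ ≤ (A ^ (N + 1) * B ^ (N + 1)) ^ 2 * ‖fc f k‖ ^ 2 := by
        gcongr
        exact le_self_pow₀ (one_le_mul_of_one_le_of_one_le hAN hBN) two_ne_zero
    _ = _ := by ring

end Decay

/-- Interchange of a weighted family of sums, for weights that add up to at most one. -/
lemma tsum_tsum_weight_comm {P Q : Type*} {w : P → Q → ℝ} (h0 : ∀ p q, 0 ≤ w p q)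
    (hw : ∀ q, Summable fun p => w p q) (h1 : ∀ q, ∑' p, w p q ≤ 1) {c : Q → ℂ}
    (hc : Summable fun q => ‖c q‖) :
    ∑' p, ∑' q, (w p q : ℂ) * c q = ∑' q, ((∑' p, w p q : ℝ) : ℂ) * c q := by
  have hs : Summable (Function.uncurry fun (q : Q) (p : P) => (w p q : ℂ) * c q) := by
    refine Summable.of_norm ?_
    have hn : ∀ q p, ‖(w p q : ℂ) * c q‖ = w p q * ‖c q‖ := fun q p => by
      rw [norm_mul, Complex.norm_real, Real.norm_of_nonneg (h0 p q)]
    rw [summable_prod_of_nonneg fun _ => norm_nonneg _]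
    simp only [Function.uncurry_apply_pair, hn]
    refine ⟨fun q => (hw q).mul_right _, hc.of_nonneg_of_le (fun q => tsum_nonneg fun p =>
      mul_nonneg (h0 p q) (norm_nonneg _)) fun q => ?_⟩
    rw [tsum_mul_right]
    exact mul_le_of_le_one_left (norm_nonneg _) (h1 q)
  rw [hs.tsum_comm]
  refine tsum_congr fun q => ?_
  rw [tsum_mul_right, Complex.ofReal_tsum]

section Expansion

variable {χ θ : ℝ → ℝ} {a g : ℝ × ℝ → ℝ}

/-- The coefficients of the vertical remainder as a series over pairs of frequencies. -/
def remCoef (χ θ : ℝ → ℝ) (u v : ℤ × ℤ → ℂ) (q : (ℤ × ℤ) × (ℤ × ℤ)) : ℂ :=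
  (remSymb χ θ q.1.2 q.2.2 : ℂ) * (u q.1 * v q.2)

lemma summable_remCoef (hp : IsDyadicPartition χ θ) {u v : ℤ × ℤ → ℂ}
    (hu : Summable fun k => ‖u k‖) (hv : Summable fun k => ‖v k‖) :
    Summable fun q => ‖remCoef χ θ u v q‖ := by
  refine Summable.of_nonneg_of_le (fun _ => norm_nonneg _) (fun q => ?_)
    (hu.mul_of_nonneg hv (fun _ => norm_nonneg _) fun _ => norm_nonneg _)
  rw [remCoef, norm_mul, norm_mul, Complex.norm_real, Real.norm_of_nonneg (remSymb_nonneg hp _ _)]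
  exact mul_le_of_le_one_left (by positivity) (remSymb_le_one hp _ _)

lemma LP_mul_LP (hp : IsDyadicPartition χ θ) (hu : Summable fun k => ‖fc a k‖)
    (hv : Summable fun k => ‖fc g k‖) (i j : ℤ) (x : ℝ × ℝ) :
    LP χ θ i a x * LP χ θ j g x = ∑' q : (ℤ × ℤ) × (ℤ × ℤ),
      ((blockSymb χ θ i q.1.2 * blockSymb χ θ j q.2.2 : ℝ) : ℂ) *
        (fc a q.1 * fc g q.2 * eK (q.1 + q.2) x) := by
  have hs : ∀ {f : ℝ × ℝ → ℝ} (j : ℤ), Summable (fun k => ‖fc f k‖) →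
      Summable fun k : ℤ × ℤ => ‖(blockSymb χ θ j k.2 : ℂ) * fc f k * eK k x‖ := fun j h => by
    refine Summable.of_nonneg_of_le (fun _ => norm_nonneg _) (fun k => ?_) h
    rw [norm_mul, norm_mul, norm_eK, mul_one, Complex.norm_real,
      Real.norm_of_nonneg (blockSymb_nonneg hp _ _)]
    exact mul_le_of_le_one_left (norm_nonneg _) (blockSymb_le_one hp _ _)
  have h := tsum_mul_tsum_of_summable_norm (hs i hu) (hs j hv)
  refine Eq.trans h (tsum_congr fun q => ?_)
  rw [eK_add]
  push_cast
  ring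

lemma Rv_eq_tsum (hp : IsDyadicPartition χ θ) (hu : Summable fun k => ‖fc a k‖)
    (hv : Summable fun k => ‖fc g k‖) (x : ℝ × ℝ) :
    Rv χ θ a g x = ∑' q, remCoef χ θ (fc a) (fc g) q * eK (q.1 + q.2) x := by
  have hc : Summable fun q : (ℤ × ℤ) × (ℤ × ℤ) => ‖fc a q.1 * fc g q.2 * eK (q.1 + q.2) x‖ := by
    simp only [norm_mul, norm_eK, mul_one]
    exact hu.mul_of_nonneg hv (fun _ => norm_nonneg _) fun _ => norm_nonneg _
  have h0 : ∀ (p : ℤ × ℤ) (q : (ℤ × ℤ) × (ℤ × ℤ)), 0 ≤ (if |p.1 - p.2| ≤ 1 then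
      blockSymb χ θ p.1 q.1.2 * blockSymb χ θ p.2 q.2.2 else 0) := fun p q => by
    split_ifs
    exacts [mul_nonneg (blockSymb_nonneg hp _ _) (blockSymb_nonneg hp _ _), le_rfl]
  have h := tsum_tsum_weight_comm h0 (fun q => ?_) (fun q => remSymb_le_one hp q.1.2 q.2.2) hc
  · refine Eq.trans (tsum_congr fun p => ?_) (h.trans (tsum_congr fun q => ?_))
    · split_ifs
      · exact LP_mul_LP hp hu hv _ _ x
      · simp
    · rw [remCoef, remSymb]
      ring
  · refine (summable_blockSymb_mul hp q.1.2 q.2.2).of_nonneg_of_le (fun p => h0 p q) fun p => ?_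
    split_ifs
    exacts [le_rfl, mul_nonneg (blockSymb_nonneg hp _ _) (blockSymb_nonneg hp _ _)]

lemma LPC_tsum (hp : IsDyadicPartition χ θ) {ι : Type*} [Countable ι] {c : ι → ℂ}
    (hc : Summable fun i => ‖c i‖) (κ : ι → ℤ × ℤ) (j : ℤ) (x : ℝ × ℝ) :
    LPC χ θ j (fun x => ∑' i, c i * eK (κ i) x) x =
      ∑' i, (blockSymb χ θ j (κ i).2 : ℂ) * c i * eK (κ i) x := by
  classical
  have hc' : Summable fun i => ‖(blockSymb χ θ j (κ i).2 : ℂ) * c i * eK (κ i) x‖ := by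
    refine Summable.of_nonneg_of_le (fun _ => norm_nonneg _) (fun i => ?_) hc
    rw [norm_mul, norm_mul, norm_eK, mul_one, Complex.norm_real,
      Real.norm_of_nonneg (blockSymb_nonneg hp _ _)]
    exact mul_le_of_le_one_left (norm_nonneg _) (blockSymb_le_one hp _ _)
  have hw : ∀ i, HasSum (fun k => if k = κ i then (1 : ℝ) else 0) 1 := fun i =>
    hasSum_ite_eq (κ i) 1
  have h := tsum_tsum_weight_comm (w := fun k i => if k = κ i then (1 : ℝ) else 0)
    (fun k i => by split_ifs <;> norm_num) (fun i => (hw i).summable)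
    (fun i => (hw i).tsum_eq.le) hc'
  refine Eq.trans (tsum_congr fun k => ?_) (h.trans (tsum_congr fun i => ?_))
  · rw [fcC_tsum hc, ← tsum_mul_left, ← tsum_mul_right]
    refine tsum_congr fun i => ?_
    by_cases hk : k = κ i
    · simp [hk]
    · simp [hk, Ne.symm hk]
  · rw [(hw i).tsum_eq, Complex.ofReal_one, one_mul]

/-- The horizontal profile of the vertical frequency `m`. -/
def hprof (u : ℤ × ℤ → ℂ) (m : ℤ) (x : ℝ) : ℂ := ∑' k : ℤ, u (k, m) * e1 k x

lemma summable_section {u : ℤ × ℤ → ℂ} (hu : Summable fun k => ‖u k‖) (m : ℤ) :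
    Summable fun k => ‖u (k, m)‖ :=
  ((Equiv.prodComm ℤ ℤ).summable_iff.2 hu).prod_factor m

lemma continuous_hprof {u : ℤ × ℤ → ℂ} (hu : Summable fun k => ‖u k‖) (m : ℤ) :
    Continuous (hprof u m) :=
  continuous_tsum (fun k => continuous_const.mul (continuous_e1 k)) (summable_section hu m)
    fun n x => by simp [norm_e1]

lemma summable_norm_hprof {u : ℤ × ℤ → ℂ} (hu : Summable fun k => ‖u k‖) (x : ℝ) :
    Summable fun m => ‖hprof u m x‖ := by
  have hu' := ((Equiv.prodComm ℤ ℤ).summable_iff.2 hu).prod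
  refine Summable.of_nonneg_of_le (fun _ => norm_nonneg _) (fun m => ?_) hu'
  refine (norm_tsum_le_tsum_norm ?_).trans_eq ?_
  · simpa [norm_e1] using summable_section hu m
  · simp [norm_e1]

/-- The coefficients in the vertical variable of a block of the vertical remainder. -/
def vcoef (χ θ : ℝ → ℝ) (u v : ℤ × ℤ → ℂ) (j : ℤ) (x : ℝ) (p : ℤ × ℤ) : ℂ :=
  (blockSymb χ θ j (p.1 + p.2 : ℤ) : ℂ) *
    ((remSymb χ θ p.1 p.2 : ℂ) * (hprof u p.1 x * hprof v p.2 x))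

lemma norm_vcoef (hp : IsDyadicPartition χ θ) (u v : ℤ × ℤ → ℂ) (j : ℤ) (x : ℝ) (p : ℤ × ℤ) :
    ‖vcoef χ θ u v j x p‖ = blockSymb χ θ j (p.1 + p.2 : ℤ) *
      (remSymb χ θ p.1 p.2 * (‖hprof u p.1 x‖ * ‖hprof v p.2 x‖)) := by
  rw [vcoef, norm_mul, norm_mul, norm_mul, Complex.norm_real, Complex.norm_real,
    Real.norm_of_nonneg (blockSymb_nonneg hp _ _), Real.norm_of_nonneg (remSymb_nonneg hp _ _)]

lemma summable_vcoef (hp : IsDyadicPartition χ θ) {u v : ℤ × ℤ → ℂ}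
    (hu : Summable fun k => ‖u k‖) (hv : Summable fun k => ‖v k‖) (j : ℤ) (x : ℝ) :
    Summable fun p => ‖vcoef χ θ u v j x p‖ := by
  refine Summable.of_nonneg_of_le (fun _ => norm_nonneg _) (fun p => ?_)
    ((summable_norm_hprof hu x).mul_of_nonneg (summable_norm_hprof hv x)
      (fun _ => norm_nonneg _) fun _ => norm_nonneg _)
  rw [norm_vcoef hp]
  have h := remSymb_nonneg hp p.1 p.2
  refine (mul_le_of_le_one_left (by positivity) (blockSymb_le_one hp _ _)).trans ?_
  exact mul_le_of_le_one_left (by positivity) (remSymb_le_one hp _ _)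

/-- A block of the vertical remainder as an absolutely convergent double Fourier series. -/
lemma LPC_Rv_eq_tsum (hp : IsDyadicPartition χ θ) (hu : Summable fun k => ‖fc a k‖)
    (hv : Summable fun k => ‖fc g k‖) (j : ℤ) (x : ℝ × ℝ) :
    LPC χ θ j (Rv χ θ a g) x = ∑' q : (ℤ × ℤ) × (ℤ × ℤ),
      (blockSymb χ θ j (q.1 + q.2).2 : ℂ) * remCoef χ θ (fc a) (fc g) q * eK (q.1 + q.2) x := by
  rw [show Rv χ θ a g = _ from funext (Rv_eq_tsum hp hu hv)]
  exact LPC_tsum hp (summable_remCoef hp hu hv) _ j x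

lemma norm_LPC_Rv_term_le (hp : IsDyadicPartition χ θ) (u v : ℤ × ℤ → ℂ) (j : ℤ)
    (q : (ℤ × ℤ) × (ℤ × ℤ)) (x : ℝ × ℝ) :
    ‖(blockSymb χ θ j (q.1 + q.2).2 : ℂ) * remCoef χ θ u v q * eK (q.1 + q.2) x‖ ≤
      ‖remCoef χ θ u v q‖ := by
  rw [norm_mul, norm_mul, norm_eK, mul_one, Complex.norm_real,
    Real.norm_of_nonneg (blockSymb_nonneg hp _ _)]
  exact mul_le_of_le_one_left (norm_nonneg _) (blockSymb_le_one hp _ _)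

lemma continuous_LPC_Rv (hp : IsDyadicPartition χ θ) (hu : Summable fun k => ‖fc a k‖)
    (hv : Summable fun k => ‖fc g k‖) (j : ℤ) : Continuous (LPC χ θ j (Rv χ θ a g)) := by
  rw [show LPC χ θ j (Rv χ θ a g) = _ from funext (LPC_Rv_eq_tsum hp hu hv j)]
  exact continuous_tsum (fun q => continuous_const.mul (continuous_eK _))
    (summable_remCoef hp hu hv) fun q x => norm_LPC_Rv_term_le hp _ _ j q x

lemma LPC_Rv_eq_tsum_vcoef (hp : IsDyadicPartition χ θ) (hu : Summable fun k => ‖fc a k‖)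
    (hv : Summable fun k => ‖fc g k‖) (j : ℤ) (x : ℝ × ℝ) :
    LPC χ θ j (Rv χ θ a g) x =
      ∑' p : ℤ × ℤ, vcoef χ θ (fc a) (fc g) j x.1 p * e1 (p.1 + p.2) x.2 := by
  let E : (ℤ × ℤ) × (ℤ × ℤ) ≃ (ℤ × ℤ) × (ℤ × ℤ) :=
    (Equiv.prodComm _ _).trans (Equiv.prodProdProdComm ℤ ℤ ℤ ℤ)
  have hs : Summable fun q : (ℤ × ℤ) × (ℤ × ℤ) =>
      (blockSymb χ θ j (q.1 + q.2).2 : ℂ) * remCoef χ θ (fc a) (fc g) q * eK (q.1 + q.2) x :=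
    Summable.of_norm_bounded (summable_remCoef hp hu hv) fun q => norm_LPC_Rv_term_le hp _ _ j q x
  rw [LPC_Rv_eq_tsum hp hu hv, ← E.tsum_eq]
  refine (E.summable_iff.2 hs).tsum_prod.trans (tsum_congr fun p => ?_)
  have hm : ∀ {u : ℤ × ℤ → ℂ} (m : ℤ), Summable (fun k => ‖u k‖) →
      Summable fun k => ‖u (k, m) * e1 k x.1‖ := fun m h => by
    simpa [norm_e1] using summable_section h m
  rw [vcoef, hprof, hprof, tsum_mul_tsum_of_summable_norm (hm _ hu) (hm _ hv), ← tsum_mul_left,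
    ← tsum_mul_left, ← tsum_mul_right]
  refine tsum_congr fun q => ?_
  simp only [E, Function.comp_apply, Equiv.trans_apply, Equiv.prodComm_apply, Equiv.prodProdProdComm_apply,
    Prod.swap_prod_mk, remCoef, eK_eq, Prod.fst_add, Prod.snd_add, e1_add]
  ring

end Expansion

section Slice

variable {χ θ : ℝ → ℝ} {a g : ℝ × ℝ → ℝ}

lemma tsum_jb_neg_ne_top {t : ℝ} (ht : 1 / 2 < t) : ∑' n, jb (-t) n ≠ ⊤ := by
  unfold jb
  rw [← ENNReal.ofReal_tsum_of_nonneg (fun n => by positivity) (summable_jb ht)]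
  exact ENNReal.ofReal_ne_top

lemma tsum_sq_le_jb (t : ℝ) (β : ℤ → ENNReal) :
    (∑' l, β l) ^ 2 ≤ (∑' l, jb (-t) l) * ∑' l, jb t l * β l ^ 2 := by
  have h := tsum_mul_sq_le (fun l => jb (-t / 2) l) fun l => jb (t / 2) l * β l
  simp only [← mul_assoc, jb_mul_jb, mul_pow, jb_sq] at h
  ring_nf at h ⊢
  simpa only [jb_zero, one_mul] using h

lemma exists_jb_mul_remSymb_le (hp : IsDyadicPartition χ θ) {t : ℝ} (ht : 0 ≤ t) :
    ∃ M : ENNReal, M ≠ ⊤ ∧ ∀ m l : ℤ,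
      jb t (m + l) * ENNReal.ofReal (remSymb χ θ m l) ≤ M * jb t m := by
  obtain ⟨D, hD, h⟩ := exists_remSymb_support hp
  refine ⟨ENNReal.ofReal (D ^ t), ENNReal.ofReal_ne_top, fun m l => ?_⟩
  rcases eq_or_ne (remSymb χ θ m l) 0 with h0 | h0
  · simp [h0]
  refine (mul_le_of_le_one_right' (ENNReal.ofReal_le_one.2 (remSymb_le_one hp m l))).trans ?_
  rw [jb, jb, ← ENNReal.ofReal_mul (by positivity), ← Real.mul_rpow (by positivity) (by positivity)]
  exact ENNReal.ofReal_le_ofReal (Real.rpow_le_rpow (by positivity) (h m l h0) ht)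

/-- The discrete estimate behind the remainder bound: weighted summation over the blocks of a
convolution localized by the remainder symbol. -/
lemma exists_tsum_block_conv_le (hp : IsDyadicPartition χ θ) {s₀ s : ℝ} (hs₀ : 1 / 2 < s₀)
    (hs : 0 ≤ s) :
    ∃ M : ENNReal, M ≠ ⊤ ∧ ∀ α β : ℤ → ENNReal,
      ∑' j : ℤ, ENNReal.ofReal ((2 : ℝ) ^ (2 * (j : ℝ) * s)) *
        ∑' n : ℤ, ENNReal.ofReal (blockSymb χ θ j n) ^ 2 *
          (∑' m, ENNReal.ofReal (remSymb χ θ m (n - m)) * (α m * β (n - m))) ^ 2 ≤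
      M * ((∑' m, jb s m * α m ^ 2) * ∑' l, jb s₀ l * β l ^ 2) := by
  obtain ⟨K, -, hK⟩ := exists_tsum_blockSymb_sq_le hp hs
  obtain ⟨M, hM, hrem⟩ := exists_jb_mul_remSymb_le hp (t := s / 2) (by linarith)
  refine ⟨ENNReal.ofReal K * (M ^ 2 * ∑' n, jb (-s₀) n), ENNReal.mul_ne_top ENNReal.ofReal_ne_top
    (ENNReal.mul_ne_top (ENNReal.pow_ne_top hM) (tsum_jb_neg_ne_top hs₀)), fun α β => ?_⟩
  set T : ℤ → ENNReal := fun n =>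
    ∑' m, ENNReal.ofReal (remSymb χ θ m (n - m)) * (α m * β (n - m)) with hT
  have hTn : ∀ n, jb s n * T n ^ 2 ≤ M ^ 2 * (∑' m, jb (s / 2) m * α m * β (n - m)) ^ 2 := by
    intro n
    rw [show s = 2 * (s / 2) by ring, ← jb_sq, ← mul_pow, ← mul_pow,
      show 2 * (s / 2) / 2 = s / 2 by ring]
    refine pow_le_pow_left' ?_ 2
    rw [hT, ← ENNReal.tsum_mul_left, ← ENNReal.tsum_mul_left]
    refine ENNReal.tsum_le_tsum fun m => ?_
    have := hrem m (n - m)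
    rw [add_sub_cancel] at this
    calc _ = jb (s / 2) n * ENNReal.ofReal (remSymb χ θ m (n - m)) * (α m * β (n - m)) := by ring
      _ ≤ M * jb (s / 2) m * (α m * β (n - m)) := by gcongr
      _ = _ := by ring
  calc _ = ∑' n : ℤ, (∑' j : ℤ, ENNReal.ofReal ((2 : ℝ) ^ (2 * (j : ℝ) * s)) *
        ENNReal.ofReal (blockSymb χ θ j n) ^ 2) * T n ^ 2 := by
        simp only [← ENNReal.tsum_mul_left, ← ENNReal.tsum_mul_right]
        rw [ENNReal.tsum_comm]
        simp only [mul_assoc, hT]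
    _ ≤ ∑' n : ℤ, ENNReal.ofReal K * (M ^ 2 * (∑' m, jb (s / 2) m * α m * β (n - m)) ^ 2) := by
        refine ENNReal.tsum_le_tsum fun n => ?_
        calc _ ≤ ENNReal.ofReal K * jb s n * T n ^ 2 := by gcongr; exact hK n
          _ = ENNReal.ofReal K * (jb s n * T n ^ 2) := by ring
          _ ≤ _ := mul_le_mul_right (hTn n) _
    _ ≤ ENNReal.ofReal K * (M ^ 2 * ((∑' m, (jb (s / 2) m * α m) ^ 2) * (∑' l, β l) ^ 2)) := by
        rw [ENNReal.tsum_mul_left, ENNReal.tsum_mul_left]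
        gcongr
        exact tsum_conv_sq_le (fun m => jb (s / 2) m * α m) β
    _ ≤ ENNReal.ofReal K * (M ^ 2 * ((∑' m, jb s m * α m ^ 2) *
          ((∑' l, jb (-s₀) l) * ∑' l, jb s₀ l * β l ^ 2))) := by
        simp only [mul_pow, jb_sq, show 2 * (s / 2) = s by ring]
        gcongr
        exact tsum_sq_le_jb s₀ β
    _ = _ := by ring

/-- Bessel's inequality in the vertical variable for a block of the remainder. -/
lemma lintegral_sq_LPC_Rv_le (hp : IsDyadicPartition χ θ) (hu : Summable fun k => ‖fc a k‖)
    (hv : Summable fun k => ‖fc g k‖) (j : ℤ) (x : ℝ) :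
    ∫⁻ y in I2pi, ‖LPC χ θ j (Rv χ θ a g) (x, y)‖ₑ ^ 2 ≤ ENNReal.ofReal (2 * π) *
      ∑' n : ℤ, ENNReal.ofReal (blockSymb χ θ j n) ^ 2 *
        (∑' m, ENNReal.ofReal (remSymb χ θ m (n - m)) *
          (‖hprof (fc a) m x‖ₑ * ‖hprof (fc g) (n - m) x‖ₑ)) ^ 2 := by
  simp only [LPC_Rv_eq_tsum_vcoef hp hu hv]
  refine (lintegral_sq_tsum_conv_le (summable_vcoef hp hu hv j x)).trans_eq ?_
  congr 1
  refine tsum_congr fun n => ?_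
  rw [← mul_pow, ← ENNReal.tsum_mul_left]
  congr 1
  refine tsum_congr fun m => ?_
  rw [← ofReal_norm, norm_vcoef hp, ENNReal.ofReal_mul (blockSymb_nonneg hp _ _),
    ENNReal.ofReal_mul (remSymb_nonneg hp _ _), ENNReal.ofReal_mul (norm_nonneg _),
    ofReal_norm, ofReal_norm]
  simp

lemma exists_slice_estimate (hp : IsDyadicPartition χ θ) {s₀ s : ℝ} (hs₀ : 1 / 2 < s₀)
    (hs : 0 ≤ s) :
    ∃ M : ENNReal, M ≠ ⊤ ∧ ∀ a g : ℝ × ℝ → ℝ, (Summable fun k => ‖fc a k‖) →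
      (Summable fun k => ‖fc g k‖) → ∀ x : ℝ,
      ∑' j : ℤ, ENNReal.ofReal ((2 : ℝ) ^ (2 * (j : ℝ) * s)) *
        ∫⁻ y in I2pi, ‖LPC χ θ j (Rv χ θ a g) (x, y)‖ₑ ^ 2 ≤
      M * ((∑' m, jb s m * ‖hprof (fc a) m x‖ₑ ^ 2) *
        ∑' l, jb s₀ l * ‖hprof (fc g) l x‖ₑ ^ 2) := by
  obtain ⟨M, hM, h⟩ := exists_tsum_block_conv_le hp hs₀ hs
  refine ⟨ENNReal.ofReal (2 * π) * M, ENNReal.mul_ne_top ENNReal.ofReal_ne_top hM,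
    fun a g hu hv x => ?_⟩
  rw [mul_assoc]
  refine le_trans ?_ (mul_le_mul_right (h (fun m => ‖hprof (fc a) m x‖ₑ)
    fun l => ‖hprof (fc g) l x‖ₑ) _)
  rw [← ENNReal.tsum_mul_left]
  refine ENNReal.tsum_le_tsum fun j => ?_
  rw [mul_left_comm]
  gcongr
  exact lintegral_sq_LPC_Rv_le hp hu hv j x

lemma HSq_eq_tsum {f : ℝ × ℝ → ℝ} (hf : Smooth f) (hper : Per f) (t s : ℝ) :
    ENNReal.ofReal (HSq t s f) = ∑' m, jb s m * ∑' k, jb t k * ‖fc f (k, m)‖ₑ ^ 2 := by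
  rw [HSq, ENNReal.ofReal_tsum_of_nonneg (fun k => by unfold aw; positivity)
    (summable_aw_mul_fc_sq hf hper t s), ENNReal.tsum_prod', ENNReal.tsum_comm]
  refine tsum_congr fun m => ?_
  rw [← ENNReal.tsum_mul_left]
  refine tsum_congr fun k => ?_
  rw [aw, ENNReal.ofReal_mul (by positivity), ENNReal.ofReal_mul (by positivity),
    ENNReal.ofReal_pow (norm_nonneg _), ofReal_norm, jb, jb]
  ring

lemma measurable_hprof_sum {u : ℤ × ℤ → ℂ} (hu : Summable fun k => ‖u k‖) (s : ℝ) :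
    Measurable fun x => ∑' m, jb s m * ‖hprof u m x‖ₑ ^ 2 :=
  Measurable.tsum fun m => ((continuous_hprof hu m).measurable.enorm.pow_const 2).const_mul _

lemma lintegral_hprof_sum_sq_le {f : ℝ × ℝ → ℝ} (hf : Smooth f) (hper : Per f) (s : ℝ) :
    ∫⁻ x in I2pi, (∑' m, jb s m * ‖hprof (fc f) m x‖ₑ ^ 2) ^ 2 ≤
      (32 * ENNReal.ofReal (HSq (1 / 4) s f)) ^ 2 := by
  have hu := summable_norm_fc hf hper
  rw [HSq_eq_tsum hf hper, ← ENNReal.tsum_mul_left]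
  refine lintegral_tsum_sq_le _
    (fun m => ((continuous_hprof hu m).measurable.enorm.pow_const 2).const_mul _) fun m => ?_
  simp only [mul_pow, ← pow_mul]
  rw [lintegral_const_mul' _ _ (by simp [jb])]
  calc _ ≤ jb s m ^ 2 * (32 * ∑' k, jb (1 / 4) k * ‖fc f (k, m)‖ₑ ^ 2) ^ 2 := by
        gcongr
        exact lintegral_pow_four_le (summable_section hu m)
    _ = _ := by ring

lemma lintegral_hprof_sum {f : ℝ × ℝ → ℝ} (hf : Smooth f) (hper : Per f) (s : ℝ) :
    ∫⁻ x in I2pi, ∑' m, jb s m * ‖hprof (fc f) m x‖ₑ ^ 2 =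
      ENNReal.ofReal (2 * π) * ENNReal.ofReal (HSq 0 s f) := by
  have hu := summable_norm_fc hf hper
  rw [HSq_eq_tsum hf hper, ← ENNReal.tsum_mul_left, lintegral_tsum fun m =>
    (((continuous_hprof hu m).measurable.enorm.pow_const 2).const_mul _).aemeasurable]
  refine tsum_congr fun m => ?_
  rw [lintegral_const_mul' _ _ (by simp [jb]), mul_left_comm]
  congr 1
  simp only [jb_zero, one_mul]
  exact lintegral_sq_tsum_e1 (summable_section hu m)

end Slice

/-- Hölder's inequality for `L^{4/3}` with a weight `w`, finite a.e. and positive where `F ≠ 0`. -/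
lemma lintegral_rpow_four_thirds_le {X : Type*} [MeasurableSpace X] (μ : Measure X)
    {F w : X → ENNReal} (hF : AEMeasurable F μ) (hw : AEMeasurable w μ) (htop : ∀ᵐ x ∂μ, w x ≠ ⊤)
    (h0 : ∀ x, w x = 0 → F x = 0) :
    (∫⁻ x, F x ^ (4 / 3 : ℝ) ∂μ) ^ (3 / 2 : ℝ) ≤
      (∫⁻ x, (w x)⁻¹ * F x ^ 2 ∂μ) * (∫⁻ x, w x ^ 2 ∂μ) ^ (1 / 2 : ℝ) := by
  have hpq : (3 / 2 : ℝ).HolderConjugate 3 := by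
    rw [Real.holderConjugate_iff]; norm_num
  have hm : AEMeasurable (fun x => (w x)⁻¹ * F x ^ 2) μ := hw.inv.mul (hF.pow_const 2)
  have h := ENNReal.lintegral_mul_le_Lp_mul_Lq μ hpq
    (f := fun x => ((w x)⁻¹ * F x ^ 2) ^ (2 / 3 : ℝ)) (g := fun x => w x ^ (2 / 3 : ℝ))
    (hm.pow_const _) (hw.pow_const _)
  have hpt : ∫⁻ x, F x ^ (4 / 3 : ℝ) ∂μ ≤
      ∫⁻ x, ((w x)⁻¹ * F x ^ 2) ^ (2 / 3 : ℝ) * w x ^ (2 / 3 : ℝ) ∂μ := by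
    refine lintegral_mono_ae (htop.mono fun x hx => ?_)
    rcases eq_or_ne (w x) 0 with hx0 | hx0
    · rw [h0 x hx0, ENNReal.zero_rpow_of_pos (by norm_num)]
      exact zero_le
    · rw [← ENNReal.mul_rpow_of_nonneg _ _ (by norm_num), mul_right_comm,
        ENNReal.inv_mul_cancel hx0 hx, one_mul, ← ENNReal.rpow_two, ← ENNReal.rpow_mul]
      norm_num
  refine (ENNReal.rpow_le_rpow (hpt.trans h) (by norm_num)).trans_eq ?_
  have h3 : ∀ x, (w x ^ (2 / 3 : ℝ)) ^ (3 : ℝ) = w x ^ 2 := fun x => by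
    rw [← ENNReal.rpow_mul, ← ENNReal.rpow_two]; norm_num
  have h4 : ∀ x, (((w x)⁻¹ * F x ^ 2) ^ (2 / 3 : ℝ)) ^ (3 / 2 : ℝ) = (w x)⁻¹ * F x ^ 2 :=
    fun x => by rw [← ENNReal.rpow_mul]; norm_num
  simp only [h3, h4]
  rw [ENNReal.mul_rpow_of_nonneg _ _ (by norm_num), ← ENNReal.rpow_mul, ← ENNReal.rpow_mul]
  norm_num

lemma ofReal_integral_le_lintegral_ofReal {X : Type*} [MeasurableSpace X] (μ : Measure X)
    {h : X → ℝ} (h0 : ∀ x, 0 ≤ h x) :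
    ENNReal.ofReal (∫ x, h x ∂μ) ≤ ∫⁻ x, ENNReal.ofReal (h x) ∂μ := by
  rw [← Real.enorm_of_nonneg (integral_nonneg h0)]
  refine (enorm_integral_le_lintegral_enorm h).trans_eq (lintegral_congr fun x => ?_)
  rw [Real.enorm_of_nonneg (h0 x)]

lemma ofReal_L2vL43h_sq_le (f : ℝ × ℝ → ℂ) :
    ENNReal.ofReal (L2vL43h f ^ 2) ≤
      ∫⁻ y in I2pi, (∫⁻ x in I2pi, ‖f (x, y)‖ₑ ^ (4 / 3 : ℝ)) ^ (3 / 2 : ℝ) := by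
  have h1 : ∀ y, 0 ≤ ∫ x in I2pi, ‖f (x, y)‖ ^ (4 / 3 : ℝ) := fun y =>
    integral_nonneg fun x => by positivity
  have h2 : ∀ y, 0 ≤ (∫ x in I2pi, ‖f (x, y)‖ ^ (4 / 3 : ℝ)) ^ (3 / 2 : ℝ) := fun y =>
    Real.rpow_nonneg (h1 y) _
  rw [L2vL43h, Real.sq_sqrt (integral_nonneg h2)]
  refine (ofReal_integral_le_lintegral_ofReal _ h2).trans (lintegral_mono fun y => ?_)
  rw [← ENNReal.ofReal_rpow_of_nonneg (h1 y) (by norm_num)]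
  refine ENNReal.rpow_le_rpow ?_ (by norm_num)
  refine (ofReal_integral_le_lintegral_ofReal _ fun x => by positivity).trans_eq
    (lintegral_congr fun x => ?_)
  rw [← ENNReal.ofReal_rpow_of_nonneg (norm_nonneg _) (by norm_num), ofReal_norm]

section Remainder

variable {χ θ : ℝ → ℝ} {a g : ℝ × ℝ → ℝ}

lemma LPC_Rv_eq_zero (hp : IsDyadicPartition χ θ) (hu : Summable fun k => ‖fc a k‖)
    (hv : Summable fun k => ‖fc g k‖) (s : ℝ) (j : ℤ) {x : ℝ}
    (hx : ∑' m, jb s m * ‖hprof (fc a) m x‖ₑ ^ 2 = 0) (y : ℝ) :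
    LPC χ θ j (Rv χ θ a g) (x, y) = 0 := by
  have h : ∀ m, hprof (fc a) m x = 0 := fun m => by
    have hj : jb s m ≠ 0 := by
      rw [jb, Ne, ENNReal.ofReal_eq_zero, not_le]; positivity
    simpa [hj] using ENNReal.tsum_eq_zero.1 hx m
  rw [LPC_Rv_eq_tsum_vcoef hp hu hv]
  simp [vcoef, h]

lemma exists_tsum_lintegral_LPC_Rv_le (hp : IsDyadicPartition χ θ) {s₀ s : ℝ} (hs₀ : 1 / 2 < s₀)
    (hs : 0 ≤ s) :
    ∃ M : ENNReal, M ≠ ⊤ ∧ ∀ a g : ℝ × ℝ → ℝ, Smooth a → Per a → Smooth g → Per g →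
      ∑' j : ℤ, ENNReal.ofReal ((2 : ℝ) ^ (2 * (j : ℝ) * s)) *
        ∫⁻ y in I2pi, (∫⁻ x in I2pi,
          ‖LPC χ θ j (Rv χ θ a g) (x, y)‖ₑ ^ (4 / 3 : ℝ)) ^ (3 / 2 : ℝ) ≤
      M * (ENNReal.ofReal (HSq (1 / 4) s a) * ENNReal.ofReal (HSq 0 s₀ g)) := by
  obtain ⟨M, hM, hslice⟩ := exists_slice_estimate hp hs₀ hs
  refine ⟨M * ENNReal.ofReal (2 * π) * 32, ENNReal.mul_ne_top
    (ENNReal.mul_ne_top hM ENNReal.ofReal_ne_top) (by norm_num), fun a g ha hpa hg hpg => ?_⟩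
  have hu := summable_norm_fc ha hpa
  have hv := summable_norm_fc hg hpg
  set w : ℝ → ENNReal := fun x => ∑' m, jb s m * ‖hprof (fc a) m x‖ₑ ^ 2
  set v : ℝ → ENNReal := fun x => ∑' l, jb s₀ l * ‖hprof (fc g) l x‖ₑ ^ 2
  set F : ℤ → ℝ × ℝ → ENNReal := fun j x => ‖LPC χ θ j (Rv χ θ a g) x‖ₑ
  have hF : ∀ j, Measurable (F j) := fun j => (continuous_LPC_Rv hp hu hv j).measurable.enorm
  have hw : Measurable w := measurable_hprof_sum hu s
  set A := ENNReal.ofReal (HSq (1 / 4) s a)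
  have hwA : ∫⁻ x in I2pi, w x ^ 2 ≤ (32 * A) ^ 2 := lintegral_hprof_sum_sq_le ha hpa s
  have htop : ∀ᵐ x ∂volume.restrict I2pi, w x ≠ ⊤ := by
    have : ∫⁻ x in I2pi, w x ^ 2 ≠ ⊤ := ne_top_of_le_ne_top
      (ENNReal.pow_ne_top (ENNReal.mul_ne_top (by norm_num) ENNReal.ofReal_ne_top)) hwA
    filter_upwards [ae_lt_top (hw.pow_const 2) this] with x hx h
    simp [h] at hx
  have hW : (∫⁻ x in I2pi, w x ^ 2) ^ (1 / 2 : ℝ) ≤ 32 * A := by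
    refine (ENNReal.rpow_le_rpow hwA (by norm_num)).trans_eq ?_
    rw [← ENNReal.rpow_two, ← ENNReal.rpow_mul]
    norm_num
  have hj : ∀ j, ∫⁻ y in I2pi, (∫⁻ x in I2pi, F j (x, y) ^ (4 / 3 : ℝ)) ^ (3 / 2 : ℝ) ≤
      (∫⁻ x in I2pi, (w x)⁻¹ * ∫⁻ y in I2pi, F j (x, y) ^ 2) * (32 * A) := by
    intro j
    have hm : Measurable (Function.uncurry fun y x => (w x)⁻¹ * F j (x, y) ^ 2) :=
      (hw.comp measurable_snd).inv.mul (((hF j).comp measurable_swap).pow_const 2)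
    calc _ ≤ ∫⁻ y in I2pi, (∫⁻ x in I2pi, (w x)⁻¹ * F j (x, y) ^ 2) * (32 * A) := by
          refine lintegral_mono fun y => ?_
          refine (lintegral_rpow_four_thirds_le _
            ((hF j).comp measurable_prodMk_right).aemeasurable hw.aemeasurable htop
            fun x hx => ?_).trans (mul_le_mul_right hW _)
          simp [F, LPC_Rv_eq_zero hp hu hv s j hx y]
      _ = _ := by
          rw [lintegral_mul_const' _ _ (ENNReal.mul_ne_top (by norm_num) ENNReal.ofReal_ne_top),
            lintegral_lintegral_swap hm.aemeasurable]
          congr 1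
          refine lintegral_congr fun x => ?_
          exact lintegral_const_mul _ (((hF j).comp measurable_prodMk_left).pow_const 2)
  have hI : ∀ j, Measurable fun x => ∫⁻ y in I2pi, F j (x, y) ^ 2 := fun j =>
    ((hF j).pow_const 2).lintegral_prod_right'
  have hwI : ∀ j : ℤ, Measurable fun x =>
      (w x)⁻¹ * ENNReal.ofReal ((2 : ℝ) ^ (2 * (j : ℝ) * s)) * ∫⁻ y in I2pi, F j (x, y) ^ 2 := fun j => (hw.inv.mul_const _).mul (hI j)
  calc _ ≤ ∑' j : ℤ, ENNReal.ofReal ((2 : ℝ) ^ (2 * (j : ℝ) * s)) *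
        ((∫⁻ x in I2pi, (w x)⁻¹ * ∫⁻ y in I2pi, F j (x, y) ^ 2) * (32 * A)) :=
        ENNReal.tsum_le_tsum fun j => mul_le_mul_right (hj j) _
    _ = (∫⁻ x in I2pi, (w x)⁻¹ * ∑' j : ℤ, ENNReal.ofReal ((2 : ℝ) ^ (2 * (j : ℝ) * s)) *
          ∫⁻ y in I2pi, F j (x, y) ^ 2) * (32 * A) := by
        simp only [← mul_assoc, ← ENNReal.tsum_mul_left, ENNReal.tsum_mul_right]
        congr 2
        rw [lintegral_tsum fun j => (hwI j).aemeasurable]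
        refine tsum_congr fun j => ?_
        rw [← lintegral_const_mul' _ _ ENNReal.ofReal_ne_top]
        refine lintegral_congr fun x => ?_
        ring
    _ ≤ (∫⁻ x in I2pi, M * v x) * (32 * A) := by
        refine mul_le_mul_left (lintegral_mono fun x => ?_) _
        calc _ ≤ (w x)⁻¹ * (M * (w x * v x)) := mul_le_mul_right (hslice a g hu hv x) _
          _ = (w x)⁻¹ * w x * (M * v x) := by ring
          _ ≤ M * v x := mul_le_of_le_one_left' (ENNReal.inv_mul_le_one _)
    _ = M * (ENNReal.ofReal (2 * π) * ENNReal.ofReal (HSq 0 s₀ g)) * (32 * A) := by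
        rw [lintegral_const_mul' _ _ hM, lintegral_hprof_sum hg hpg]
    _ = _ := by ring

end Remainder

/-- remainder estimate
`(Σ_{k≥−1} 2^{2ks} ‖Δ^v_k R^v(a,g)‖²_{L²_v(L^{4/3}_h)})^{1/2} ≤ C ‖a‖_{H^{1/4,s}} ‖g‖_{H^{0,s₀}}`. -/
theorem remainder_Rv_estimate (χ θ : ℝ → ℝ) (hp : IsDyadicPartition χ θ)
    (s₀ s : ℝ) (hs₀ : 1/2 < s₀) (hs : s₀ ≤ s) :
    ∃ C > 0, ∀ a g : ℝ × ℝ → ℝ, Smooth a → Per a → Smooth g → Per g →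
      Real.sqrt (∑' k : {j : ℤ // -1 ≤ j},
          (2 : ℝ) ^ (2 * (k.1 : ℝ) * s) * L2vL43h (LPC χ θ k.1 (Rv χ θ a g)) ^ 2) ≤
        C * HN (1/4) s a * HN 0 s₀ g := by
  obtain ⟨M, hM, h⟩ := exists_tsum_lintegral_LPC_Rv_le hp hs₀ (by linarith : 0 ≤ s)
  refine ⟨√M.toReal + 1, by positivity, fun a g ha hpa hg hpg => ?_⟩
  have hnn : ∀ (t s : ℝ) (f : ℝ × ℝ → ℝ), 0 ≤ HSq t s f := fun t s f =>
    tsum_nonneg fun k => by unfold aw; positivity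
  have hsum : ∑' k : {j : ℤ // -1 ≤ j}, ENNReal.ofReal ((2 : ℝ) ^ (2 * (k.1 : ℝ) * s) *
      L2vL43h (LPC χ θ k.1 (Rv χ θ a g)) ^ 2) ≤
      M * (ENNReal.ofReal (HSq (1 / 4) s a) * ENNReal.ofReal (HSq 0 s₀ g)) := by
    refine le_trans ?_ ((ENNReal.tsum_comp_le_tsum_of_injective
      (Subtype.val_injective (p := fun j : ℤ => -1 ≤ j)) _).trans (h a g ha hpa hg hpg))
    refine ENNReal.tsum_le_tsum fun k => ?_
    rw [ENNReal.ofReal_mul (by positivity)]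
    exact mul_le_mul_right (ofReal_L2vL43h_sq_le _) _
  have hreal := ENNReal.toReal_mono (ENNReal.mul_ne_top hM
    (ENNReal.mul_ne_top ENNReal.ofReal_ne_top ENNReal.ofReal_ne_top)) hsum
  rw [ENNReal.tsum_toReal_eq fun _ => ENNReal.ofReal_ne_top, ENNReal.toReal_mul,
    ENNReal.toReal_mul, ENNReal.toReal_ofReal (hnn _ _ _), ENNReal.toReal_ofReal (hnn _ _ _),
    tsum_congr fun k => ENNReal.toReal_ofReal (by positivity)] at hreal
  refine (Real.sqrt_le_sqrt hreal).trans ?_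
  rw [Real.sqrt_mul ENNReal.toReal_nonneg, Real.sqrt_mul (hnn _ _ _), ← mul_assoc, HN, HN]
  gcongr
  linarith

end Aniso
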